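/- arXiv:1911.04079 — 4 statements merged into one kernel-verified Lean document; each statement's English description precedes it below -/
import Mathlib

section
/- Let N = {1,…,2n} carry a coloring with exactly n black and n white nodes. For every black-white pairing ρ of N, sign_cons(N) · sign_BW(ρ) · ∏_{(b,w) a pair of ρ} sign(b,w) = (−1)^{(number of crossings of ρ)}. -/
namespace DD

/-- The node set `{1, …, 2n}`. -/
def nodes (n : ℕ) : Finset ℕ := Finset.Icc 1 (2 * n)

/-- `ρ` is a pairing of `{1,…,2n}`: a fixed-point-free involution of the node set. -/
structure IsPairing (n : ℕ) (ρ : ℕ → ℕ) : Prop where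
  maps : ∀ i ∈ nodes n, ρ i ∈ nodes n
  invol : ∀ i ∈ nodes n, ρ (ρ i) = i
  nofix : ∀ i ∈ nodes n, ρ i ≠ i

/-- Number of crossings of `ρ` among pairs of `ρ` contained in `A`:
a crossing is a pair of pairs `(a,c)`, `(b,d)` of `ρ` with `a < b < c < d`. -/
def numCrossingsOn (A : Finset ℕ) (ρ : ℕ → ℕ) : ℕ :=
  ((A ×ˢ A).filter (fun p => p.1 < p.2 ∧ p.2 < ρ p.1 ∧ ρ p.1 < ρ p.2)).card

/-- Number of crossings of a pairing of `{1,…,2n}`. -/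
def numCrossings (n : ℕ) (ρ : ℕ → ℕ) : ℕ := numCrossingsOn (nodes n) ρ

/-- A pairing is planar if it has no crossings. -/
def IsPlanar (n : ℕ) (ρ : ℕ → ℕ) : Prop := numCrossings n ρ = 0

/-- A coloring `c : ℕ → Bool` of the nodes: `true` = black, `false` = white.
A black-white pairing pairs each black node with a white node. -/
def IsBW (n : ℕ) (c : ℕ → Bool) (ρ : ℕ → ℕ) : Prop :=
  ∀ i ∈ nodes n, c (ρ i) = !(c i)

/-- An odd-even pairing pairs each odd node with an even node. -/
def IsOE (n : ℕ) (ρ : ℕ → ℕ) : Prop :=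
  ∀ i ∈ nodes n, ρ i % 2 ≠ i % 2

/-- The coloring has exactly `n` black (hence exactly `n` white) nodes. -/
def BalancedColoring (n : ℕ) (c : ℕ → Bool) : Prop :=
  ((nodes n).filter (fun i => c i = true)).card = n

/-- The black nodes. -/
def blacks (n : ℕ) (c : ℕ → Bool) : Finset ℕ := (nodes n).filter (fun i => c i = true)

/-- The white nodes. -/
def whites (n : ℕ) (c : ℕ → Bool) : Finset ℕ := (nodes n).filter (fun i => c i = false)

/-- `sign_BW(ρ)`: the sign of the permutation sending `i` to the rank of `w_i = ρ(b_i)`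
among the white nodes, computed as `(-1)` to the number of inversions, i.e. the number of
pairs of black nodes `b < b'` with `ρ b > ρ b'`. -/
def signBW (n : ℕ) (c : ℕ → Bool) (ρ : ℕ → ℕ) : ℤ :=
  (-1 : ℤ) ^ (((nodes n ×ˢ nodes n).filter
    (fun p => c p.1 = true ∧ c p.2 = true ∧ p.1 < p.2 ∧ ρ p.2 < ρ p.1)).card)

/-- `sign_OE(π)`: the sign of the permutation sending `i` to `π(2i−1)/2`, computed as
`(-1)` to the number of pairs of odd nodes `a < b` with `π a > π b`. -/
def signOE (n : ℕ) (π : ℕ → ℕ) : ℤ :=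
  (-1 : ℤ) ^ (((nodes n ×ˢ nodes n).filter
    (fun p => p.1 % 2 = 1 ∧ p.2 % 2 = 1 ∧ p.1 < p.2 ∧ π p.2 < π p.1)).card)

/-- `a_{b,w}`: the number of indices `i` with `min b w ≤ i < max b w` such that nodes `i`
and `i+1` have the same color. -/
def aCount (c : ℕ → Bool) (b w : ℕ) : ℕ :=
  ((Finset.Ico (min b w) (max b w)).filter (fun i => c i = c (i + 1))).card

/-- `sign(b,w) = (−1)^{(|b−w| + a_{b,w} − 1)/2}` for a black node `b` and white node `w`. -/
def pairSign (c : ℕ → Bool) (b w : ℕ) : ℤ :=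
  (-1 : ℤ) ^ ((max b w - min b w + aCount c b w - 1) / 2)

/-- Cyclic successor of node `m` in `{1,…,2n}`. -/
def nextNode (n m : ℕ) : ℕ := if m = 2 * n then 1 else m + 1

/-- Couples of consecutive nodes of the same color, cyclically: indices `m ∈ {1,…,2n}`
with nodes `m` and `m+1` (cyclically) of the same color. -/
def couples (n : ℕ) (c : ℕ → Bool) : Finset ℕ :=
  (nodes n).filter (fun m => c m = c (nextNode n m))

/-- The value `φ(m)` for a couple `m`: writing `r` for the rank of `m` among couples of its
own color, `φ(m) = 2r` if `m` has the same color as node `1`, and `φ(m) = 2r − 1` otherwise. -/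
def phiCouple (n : ℕ) (c : ℕ → Bool) (m : ℕ) : ℕ :=
  if c m = c 1 then 2 * ((couples n c).filter (fun m' => c m' = c m ∧ m' ≤ m)).card
  else 2 * ((couples n c).filter (fun m' => c m' = c m ∧ m' ≤ m)).card - 1

/-- `sign_cons(N)`: the sign of the one-line permutation `(φ(n₁),…,φ(n_{2k}))`, computed
as `(-1)` to its number of inversions. -/
def signCons (n : ℕ) (c : ℕ → Bool) : ℤ :=
  (-1 : ℤ) ^ (((couples n c ×ˢ couples n c).filter
    (fun p => p.1 < p.2 ∧ phiCouple n c p.2 < phiCouple n c p.1)).card)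

/-- The set `T` of nodes that are odd and white, or even and black. -/
def Tset (n : ℕ) (c : ℕ → Bool) : Finset ℕ :=
  (nodes n).filter (fun i => (i % 2 = 1 ∧ c i = false) ∨ (i % 2 = 0 ∧ c i = true))

/-- A subset is balanced if it contains equally many black and white nodes. -/
def BalancedSubset (c : ℕ → Bool) (S : Finset ℕ) : Prop :=
  (S.filter (fun i => c i = true)).card = (S.filter (fun i => c i = false)).card

/-- `ρ` does not connect `S` to its complement: `ρ(S) = S`. -/
def Invariant (S : Finset ℕ) (ρ : ℕ → ℕ) : Prop := ∀ i ∈ S, ρ i ∈ S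

/-- Reachability under the subgroup generated by the involutions `π` and `ρ`. -/
def compRel (n : ℕ) (π ρ : ℕ → ℕ) (a b : ℕ) : Prop :=
  Relation.ReflTransGen (fun u v => u ∈ nodes n ∧ (v = π u ∨ v = ρ u)) a b

open scoped Classical in
/-- The number of components (orbits) of `π ∪ ρ` on the node set. -/
noncomputable def numComponents (n : ℕ) (π ρ : ℕ → ℕ) : ℕ :=
  ((nodes n).image (fun a => (nodes n).filter (fun b => compRel n π ρ a b))).card


section Helpers

open Finset

/-- Integer indicator of a proposition. -/
def ind (P : Prop) [Decidable P] : ℤ := if P then 1 else 0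

lemma card_filter_ind {α : Type*} (s : Finset α) (P : α → Prop) [DecidablePred P] :
    ((s.filter P).card : ℤ) = ∑ x ∈ s, ind (P x) := by
  rw [Finset.card_filter]; push_cast; rfl

/-- Symmetrization of a double sum. -/
lemma sum_pairs_symm (X : Finset ℕ) (H : ℕ → ℕ → ℤ) :
    ∑ x ∈ X, ∑ y ∈ X, H x y
      = ∑ x ∈ X, ∑ y ∈ X, ind (x < y) * (H x y + H y x) + ∑ x ∈ X, H x x := by
  have h1 : ∀ x ∈ X, ∑ y ∈ X, H x y
      = ∑ y ∈ X, ind (x < y) * H x y + ∑ y ∈ X, ind (y < x) * H x y + H x x := by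
    intro x hx
    have : H x x = ∑ y ∈ X, ind (x = y) * H x y := by
      simp [ind, hx]
    rw [this, ← Finset.sum_add_distrib, ← Finset.sum_add_distrib]
    refine Finset.sum_congr rfl fun y _ => ?_
    rcases lt_trichotomy x y with h | h | h
    · simp [ind, h, h.ne, h.not_gt]
    · simp [ind, h]
    · simp [ind, h, h.ne', h.not_gt]
  rw [Finset.sum_congr rfl h1, Finset.sum_add_distrib, Finset.sum_add_distrib]
  rw [Finset.sum_comm (f := fun x y => ind (y < x) * H x y)]
  simp only [mul_add, Finset.sum_add_distrib]

/-- Pointwise parity identity for two pairs. -/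
lemma point_parity (b b' w w' : ℕ) (h1 : b < b') (h2 : b ≠ w) (h3 : b ≠ w') (h4 : b' ≠ w)
    (h5 : b' ≠ w') (h6 : w ≠ w') :
    ((ind (b < b' ∧ b' < w ∧ w < w') + ind (b < w' ∧ w' < w ∧ w < b')
      + ind (w < b' ∧ b' < b ∧ b < w') + ind (w < w' ∧ w' < b ∧ b < b'))
     + (ind (b' < b ∧ b < w' ∧ w' < w) + ind (b' < w ∧ w < w' ∧ w' < b)
      + ind (w' < b ∧ b < b' ∧ b' < w) + ind (w' < w ∧ w < b' ∧ b' < b))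
     + ind (w' < w)) ≡ 1 + ind (w' < b) + ind (w < b') [ZMOD 2] := by
  have e : ∀ x y : ℕ, x < y → ((x < y) = True ∧ (y < x) = False) := by
    intro x y h
    exact ⟨by simp [h], by simp [h.le]⟩
  have a1 := e _ _ h1
  rcases lt_or_gt_of_ne h2 with h2 | h2 <;> rcases lt_or_gt_of_ne h3 with h3 | h3 <;>
  rcases lt_or_gt_of_ne h4 with h4 | h4 <;> rcases lt_or_gt_of_ne h5 with h5 | h5 <;>
  rcases lt_or_gt_of_ne h6 with h6 | h6 <;>
  first
  | (exfalso; omega)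
  | (have a2 := e _ _ h2
     have a3 := e _ _ h3
     have a4 := e _ _ h4
     have a5 := e _ _ h5
     have a6 := e _ _ h6
     simp only [a1.1, a1.2, a2.1, a2.2, a3.1, a3.2, a4.1, a4.2, a5.1, a5.2, a6.1, a6.2, ind]
     decide)

lemma sum_lt_pairs (X : Finset ℕ) :
    2 * ∑ x ∈ X, ∑ y ∈ X, ind (x < y) = (X.card : ℤ) * (X.card - 1) := by
  have h := sum_pairs_symm X (fun _ _ => 1)
  simp only [Finset.sum_const, nsmul_eq_mul, mul_one] at h
  have h2 : ∑ x ∈ X, ∑ y ∈ X, ind (x < y) * ((1:ℤ) + 1)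
      = 2 * ∑ x ∈ X, ∑ y ∈ X, ind (x < y) := by
    simp only [Finset.mul_sum]
    refine Finset.sum_congr rfl fun x _ => Finset.sum_congr rfl fun y _ => by ring
  rw [h2] at h
  linarith

/-- number of (black, white) pairs with white before black -/
def Dtot (n : ℕ) (c : ℕ → Bool) : ℤ := ∑ b ∈ blacks n c, ∑ w ∈ whites n c, ind (w < b)

/-- the stretched position -/
def Fpos (c : ℕ → Bool) (i : ℕ) : ℤ := i + ∑ j ∈ Ico 1 i, ind (c j = c (j + 1))

def Qtot (n : ℕ) (c : ℕ → Bool) : ℤ := ∑ w ∈ whites n c, Fpos c w - ∑ b ∈ blacks n c, Fpos c b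

lemma sum_whites (n : ℕ) (c : ℕ → Bool) (ρ : ℕ → ℕ) (hρ : IsPairing n ρ) (hbw : IsBW n c ρ)
    (g : ℕ → ℤ) : ∑ w ∈ whites n c, g w = ∑ b ∈ blacks n c, g (ρ b) := by
  symm
  refine Finset.sum_bij' (fun b _ => ρ b) (fun w _ => ρ w) ?_ ?_ ?_ ?_ ?_
  · intro a ha
    simp only [blacks, whites, mem_filter] at *
    exact ⟨hρ.maps _ ha.1, by rw [hbw _ ha.1, ha.2]; rfl⟩
  · intro a ha
    simp only [blacks, whites, mem_filter] at *
    exact ⟨hρ.maps _ ha.1, by rw [hbw _ ha.1, ha.2]; rfl⟩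
  · intro a ha
    simp only [blacks, whites, mem_filter] at *
    exact hρ.invol _ ha.1
  · intro a ha
    simp only [blacks, whites, mem_filter] at *
    exact hρ.invol _ ha.1
  · intro a ha
    rfl

lemma sum_nodes (n : ℕ) (c : ℕ → Bool) (g : ℕ → ℤ) :
    ∑ i ∈ nodes n, g i = ∑ b ∈ blacks n c, g b + ∑ w ∈ whites n c, g w := by
  rw [blacks, whites, ← Finset.sum_filter_add_sum_filter_not (nodes n) (fun i => c i = true)]
  simp

lemma cross_inv (n : ℕ) (c : ℕ → Bool) (hbal : BalancedColoring n c)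
    (ρ : ℕ → ℕ) (hρ : IsPairing n ρ) (hbw : IsBW n c ρ) (cr iv : ℕ)
    (hcr : cr = numCrossings n ρ)
    (hiv : iv = (((nodes n ×ˢ nodes n).filter
    (fun p => c p.1 = true ∧ c p.2 = true ∧ p.1 < p.2 ∧ ρ p.2 < ρ p.1)).card)) :
    2 * ((cr : ℤ) + iv) ≡ n * (n - 1) + 2 * (Dtot n c - ∑ b ∈ blacks n c, ind (ρ b < b))
      [ZMOD 4] := by
  set X := blacks n c with hX
  have hcard : (X.card : ℤ) = n := by
    have : X.card = n := hbal
    rw [this]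
  have hXm : ∀ b ∈ X, b ∈ nodes n ∧ c b = true := by
    intro b hb; simpa [hX, blacks] using hb
  have hne : ∀ b ∈ X, ∀ b' ∈ X, b ≠ ρ b' := by
    intro b hb b' hb' h
    have := hbw b' (hXm _ hb').1
    rw [← h, (hXm _ hb).2, (hXm _ hb').2] at this
    simp at this
  have hinj : ∀ b ∈ X, ∀ b' ∈ X, b ≠ b' → ρ b ≠ ρ b' := by
    intro b hb b' hb' h h'
    apply h
    rw [← hρ.invol b (hXm _ hb).1, h', hρ.invol b' (hXm _ hb').1]
  let f : ℕ → ℕ → ℤ := fun x y => ind (x < y ∧ y < ρ x ∧ ρ x < ρ y)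
  let H : ℕ → ℕ → ℤ := fun b b' => ind (b < b' ∧ b' < ρ b ∧ ρ b < ρ b')
      + ind (b < ρ b' ∧ ρ b' < ρ b ∧ ρ b < b')
      + ind (ρ b < b' ∧ b' < b ∧ b < ρ b') + ind (ρ b < ρ b' ∧ ρ b' < b ∧ b < b')
  have h1 : (cr : ℤ) = ∑ b ∈ X, ∑ b' ∈ X, H b b' := by
    rw [hcr, numCrossings, numCrossingsOn, card_filter_ind, Finset.sum_product]
    have : ∀ x, ∑ y ∈ nodes n, f x y = ∑ b' ∈ X, (f x b' + f x (ρ b')) := by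
      intro x
      rw [sum_nodes n c, sum_whites n c ρ hρ hbw, ← Finset.sum_add_distrib]
    change ∑ x ∈ nodes n, ∑ y ∈ nodes n, f x y = _
    simp only [this]
    rw [sum_nodes n c, sum_whites n c ρ hρ hbw, ← Finset.sum_add_distrib]
    refine Finset.sum_congr rfl fun b hb => ?_
    rw [← Finset.sum_add_distrib]
    refine Finset.sum_congr rfl fun b' hb' => ?_
    simp only [f, H, hρ.invol b (hXm _ hb).1, hρ.invol b' (hXm _ hb').1]
    ring
  have h2 : (iv : ℤ) = ∑ b ∈ X, ∑ b' ∈ X, ind (b < b') * ind (ρ b' < ρ b) := by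
    rw [hiv, card_filter_ind, Finset.sum_product, hX, blacks, Finset.sum_filter]
    refine Finset.sum_congr rfl fun b hb => ?_
    rw [Finset.sum_filter]
    by_cases hc : c b = true
    · simp only [hc, if_true]
      refine Finset.sum_congr rfl fun b' hb' => ?_
      by_cases h1 : c b' = true <;> by_cases h2 : b < b' <;> by_cases h3 : ρ b' < ρ b <;>
        simp [ind, h1, h2, h3]
    · simp [hc, ind]
  have h3 : Dtot n c = ∑ b ∈ X, ∑ b' ∈ X, ind (ρ b' < b) := by
    rw [Dtot]
    refine Finset.sum_congr rfl fun b hb => ?_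
    rw [sum_whites n c ρ hρ hbw]
  rw [sum_pairs_symm] at h1 h3
  have hd : ∑ x ∈ X, H x x = 0 := by
    refine Finset.sum_eq_zero fun x _ => ?_
    simp only [H, ind]
    simp
  rw [hd, add_zero] at h1
  have h4 : (cr : ℤ) + iv ≡ ∑ b ∈ X, ∑ b' ∈ X, ind (b < b')
      + (Dtot n c - ∑ b ∈ X, ind (ρ b < b)) [ZMOD 2] := by
    rw [h1, h2, h3, add_sub_cancel_right, ← Finset.sum_add_distrib, ← Finset.sum_add_distrib]
    refine Int.ModEq.sum fun b hb => ?_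
    rw [← Finset.sum_add_distrib, ← Finset.sum_add_distrib]
    refine Int.ModEq.sum fun b' hb' => ?_
    by_cases hlt : b < b'
    · have := point_parity b b' (ρ b) (ρ b') hlt (hne _ hb _ hb) (hne _ hb _ hb')
        (hne _ hb' _ hb) (hne _ hb' _ hb') (hinj _ hb _ hb' hlt.ne)
      have e1 : ind (b < b') = 1 := by simp [ind, hlt]
      rw [e1]
      simp only [H, one_mul]
      rw [add_assoc] at this
      convert this using 1 <;> ring
    · have e1 : ind (b < b') = 0 := by simp [ind, hlt]
      rw [e1]; simp
  have h5 := sum_lt_pairs X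
  rw [hcard] at h5
  rw [← h5]
  have := h4.mul_left' (c := 2)
  rw [mul_add 2 (∑ b ∈ X, ∑ b' ∈ X, ind (b < b'))] at this
  exact this

lemma Fpos_parity (c : ℕ → Bool) (i : ℕ) (hi : 1 ≤ i) :
    Fpos c i ≡ 1 + ind (c i ≠ c 1) [ZMOD 2] := by
  induction i, hi using Nat.le_induction with
  | base => simp [Fpos, ind]
  | succ m hm ih =>
    have : Fpos c (m+1) = Fpos c m + 1 + ind (c m = c (m+1)) := by
      simp only [Fpos]; rw [Finset.sum_Ico_succ_top hm]; push_cast; ring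
    rw [this]
    have h2 : ind (c m ≠ c 1) + 1 + ind (c m = c (m+1)) ≡ ind (c (m+1) ≠ c 1) [ZMOD 2] := by
      cases c m <;> cases c (m+1) <;> cases c 1 <;> decide
    have := (ih.add_right (1 + ind (c m = c (m+1))))
    rw [← add_assoc] at this
    refine this.trans ?_
    have := h2.add_left 1
    convert this using 1
    ring

lemma Fpos_sub (c : ℕ → Bool) (i j : ℕ) (hi : 1 ≤ i) (hij : i ≤ j) :
    Fpos c j - Fpos c i = ((j - i + ((Ico i j).filter (fun m => c m = c (m+1))).card : ℕ) : ℤ) := by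
  rw [Nat.cast_add, card_filter_ind, Fpos, Fpos, ← Finset.sum_Ico_consecutive _ hi hij]
  push_cast [hij]
  ring

lemma pair_exp (n : ℕ) (c : ℕ → Bool) (b w : ℕ) (hb : 1 ≤ b) (hw : 1 ≤ w) (hc : c b ≠ c w) :
    2 * (((max b w - min b w + aCount c b w - 1) / 2 : ℕ) : ℤ) + 2 * ind (w < b)
      ≡ Fpos c w - Fpos c b - 1 [ZMOD 4] := by
  have hb' := Fpos_parity c b hb
  have hw' := Fpos_parity c w hw
  have hp : Fpos c w - Fpos c b ≡ 1 [ZMOD 2] := by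
    refine (hw'.sub hb').trans ?_
    revert hc
    cases c b <;> cases c w <;> cases c 1 <;> decide
  rcases le_total b w with h | h
  · have := Fpos_sub c b w hb h
    have e : aCount c b w = ((Ico b w).filter (fun m => c m = c (m+1))).card := by
      rw [aCount, min_eq_left h, max_eq_right h]
    rw [max_eq_right h, min_eq_left h, e]
    have e2 : ind (w < b) = 0 := by simp [ind, h]
    rw [e2]
    generalize w - b + _ = z at *
    rw [this] at hp ⊢
    unfold Int.ModEq at *
    omega
  · have := Fpos_sub c w b hw h
    have e : aCount c b w = ((Ico w b).filter (fun m => c m = c (m+1))).card := by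
      rw [aCount, min_eq_right h, max_eq_left h]
    rw [max_eq_left h, min_eq_right h, e]
    have e2 : ind (w < b) = 1 := by
      have : b ≠ w := fun h => hc (by rw [h])
      simp [ind]; omega
    rw [e2]
    generalize b - w + _ = z at *
    unfold Int.ModEq at *
    omega

lemma prod_exp (n : ℕ) (c : ℕ → Bool) (hbal : BalancedColoring n c)
    (ρ : ℕ → ℕ) (hρ : IsPairing n ρ) (hbw : IsBW n c ρ) :
    ∃ E : ℕ, ∏ b ∈ blacks n c, pairSign c b (ρ b) = (-1) ^ E ∧
      2 * (E : ℤ) + 2 * ∑ b ∈ blacks n c, ind (ρ b < b) ≡ Qtot n c - n [ZMOD 4] := by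
  refine ⟨∑ b ∈ blacks n c, (max b (ρ b) - min b (ρ b) + aCount c b (ρ b) - 1) / 2, ?_, ?_⟩
  · rw [← Finset.prod_pow_eq_pow_sum]; rfl
  · have hcard : ((blacks n c).card : ℤ) = n := by
      have : (blacks n c).card = n := hbal
      rw [this]
    rw [Qtot, sum_whites n c ρ hρ hbw, ← hcard, Nat.cast_sum, Finset.mul_sum, Finset.mul_sum,
      ← Finset.sum_add_distrib, ← Finset.sum_sub_distrib]
    have : ((blacks n c).card : ℤ) = ∑ b ∈ blacks n c, 1 := by simp
    rw [this, ← Finset.sum_sub_distrib]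
    refine Int.ModEq.sum fun b hb => ?_
    simp only [blacks, mem_filter] at hb
    have h1 := hρ.maps _ hb.1
    have h2 := hbw _ hb.1
    simp only [nodes, mem_Icc] at h1 hb
    exact pair_exp n c b (ρ b) hb.1.1 h1.1 (by rw [h2]; simp)

lemma sum_rank (X : Finset ℕ) (f : ℕ → ℤ) :
    ∑ x ∈ X, f ((X.filter (fun y => y ≤ x)).card) = ∑ i ∈ range X.card, f (i + 1) := by
  induction X using Finset.induction_on_max with
  | empty => simp
  | insert a s h ih =>
    have ha : a ∉ s := fun h' => lt_irrefl _ (h a h')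
    rw [Finset.sum_insert ha, Finset.card_insert_of_notMem ha, Finset.sum_range_succ, ← ih,
      add_comm]
    congr 1
    · refine Finset.sum_congr rfl fun x hx => ?_
      rw [Finset.filter_insert, if_neg (not_le.mpr (h x hx))]
    · rw [Finset.filter_true_of_mem, Finset.card_insert_of_notMem ha]
      intro x hx
      rcases Finset.mem_insert.mp hx with h1 | h1
      · exact h1.le
      · exact (h x h1).le

lemma sum_tri (k : ℕ) :
    2 * ∑ i ∈ range k, ∑ j ∈ range k, ind (i + 1 ≤ j + 1) = (k : ℤ) * (k + 1) := by
  have h := sum_lt_pairs (range k)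
  have : ∀ i ∈ range k, ∑ j ∈ range k, ind (i + 1 ≤ j + 1) = ∑ j ∈ range k, ind (i < j) + 1 := by
    intro i hi
    have : (1 : ℤ) = ∑ j ∈ range k, ind (i = j) := by
      rw [mem_range] at hi
      simp [ind, hi]
    rw [this, ← Finset.sum_add_distrib]
    refine Finset.sum_congr rfl fun j _ => ?_
    rcases lt_trichotomy i j with h | h | h
    · simp [ind, h, h.le, h.ne]
    · simp [ind, h]
    · simp [ind, h.ne', h.not_gt, h.not_ge]
  rw [Finset.sum_congr rfl this, Finset.sum_add_distrib, mul_add, h]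
  simp
  ring

/-- Inversions of `φ` in terms of pairs of couples. -/
lemma cons_inv (n : ℕ) (c : ℕ → Bool) (S U : Finset ℕ) (k : ℕ)
    (hS : S = (couples n c).filter (fun m => c m = c 1))
    (hU : U = (couples n c).filter (fun m => ¬ c m = c 1))
    (hSk : S.card = k) (hUk : U.card = k) :
    2 * ((((couples n c ×ˢ couples n c).filter
      (fun p => p.1 < p.2 ∧ phiCouple n c p.2 < phiCouple n c p.1)).card : ℕ) : ℤ)
      ≡ 2 * (∑ s ∈ S, ∑ u ∈ U, ind (u < s)) + k * (k + 1) [ZMOD 4] := by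
  let rS : ℕ → ℕ := fun m => (S.filter (fun y => y ≤ m)).card
  let rU : ℕ → ℕ := fun m => (U.filter (fun y => y ≤ m)).card
  have hphiS : ∀ s ∈ S, phiCouple n c s = 2 * rS s := by
    intro s hs
    rw [hS, mem_filter] at hs
    simp only [phiCouple, rS, hS, Finset.filter_filter, hs.2, if_true]
  have hphiU : ∀ s ∈ U, phiCouple n c s = 2 * rU s - 1 := by
    intro s hs
    rw [hU, mem_filter] at hs
    simp only [phiCouple, if_neg hs.2, rU, hU, Finset.filter_filter]
    have : ∀ m, (c m = c s ↔ ¬ c m = c 1) := by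
      intro m
      have := hs.2
      revert this
      cases c m <;> cases c s <;> cases c 1 <;> simp
    simp only [this]
  have hposU : ∀ u ∈ U, 1 ≤ rU u := by
    intro u hu
    exact Finset.card_pos.mpr ⟨u, by simp [hu]⟩
  have hmS : ∀ x y, x ≤ y → rS x ≤ rS y := by
    intro x y h
    refine Finset.card_le_card ?_
    intro z hz
    simp only [mem_filter] at *
    exact ⟨hz.1, hz.2.trans h⟩
  have hmU : ∀ x y, x ≤ y → rU x ≤ rU y := by
    intro x y h
    refine Finset.card_le_card ?_
    intro z hz
    simp only [mem_filter] at *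
    exact ⟨hz.1, hz.2.trans h⟩
  have hsplit : ∀ g : ℕ → ℤ, ∑ m ∈ couples n c, g m = ∑ s ∈ S, g s + ∑ u ∈ U, g u := by
    intro g
    rw [hS, hU, Finset.sum_filter_add_sum_filter_not]
  have hne : ∀ s ∈ S, ∀ u ∈ U, s ≠ u := by
    intro s hs u hu h
    rw [hS, mem_filter] at hs
    rw [hU, mem_filter] at hu
    exact hu.2 (h ▸ hs.2)
  rw [card_filter_ind, Finset.sum_product]
  simp only [hsplit, Finset.sum_add_distrib]
  have hSS : ∑ x ∈ S, ∑ y ∈ S, ind (x < y ∧ phiCouple n c y < phiCouple n c x) = 0 := by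
    refine Finset.sum_eq_zero fun x hx => Finset.sum_eq_zero fun y hy => ?_
    rw [hphiS x hx, hphiS y hy, ind, if_neg]
    rintro ⟨h1, h2⟩
    have := hmS _ _ h1.le
    omega
  have hUU : ∑ x ∈ U, ∑ y ∈ U, ind (x < y ∧ phiCouple n c y < phiCouple n c x) = 0 := by
    refine Finset.sum_eq_zero fun x hx => Finset.sum_eq_zero fun y hy => ?_
    rw [hphiU x hx, hphiU y hy, ind, if_neg]
    rintro ⟨h1, h2⟩
    have := hmU _ _ h1.le
    omega
  rw [hSS, hUU, zero_add, add_zero]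
  rw [Finset.sum_comm (s := U) (t := S), ← Finset.sum_add_distrib]
  have hk : (k : ℤ) * (k + 1) = 2 * ∑ s ∈ S, ∑ u ∈ U, ind (rU u ≤ rS s) := by
    have h1 : ∀ s, ∑ u ∈ U, ind (rU u ≤ rS s) = ∑ i ∈ range k, ind (i + 1 ≤ rS s) := by
      intro s
      have := sum_rank U (fun r => ind (r ≤ rS s))
      rw [hUk] at this
      exact this
    have h2 := sum_rank S (fun r => ∑ i ∈ range k, ind (i + 1 ≤ r))
    rw [hSk] at h2
    simp only [h1]
    rw [h2, Finset.sum_comm, sum_tri]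
  rw [hk, ← mul_add]
  refine (show _ ≡ _ [ZMOD 2 * 2] from Int.ModEq.mul_left' ?_)
  rw [← Finset.sum_add_distrib]
  refine Int.ModEq.sum fun s hs => ?_
  rw [← Finset.sum_add_distrib, ← Finset.sum_add_distrib]
  refine Int.ModEq.sum fun u hu => ?_
  rw [hphiS s hs, hphiU u hu]
  have h1 := hne s hs u hu
  have h2 := hposU u hu
  simp only [ind]
  unfold Int.ModEq
  split_ifs <;> omega

/-- running sums -/
def pW (c : ℕ → Bool) (N : ℕ) : ℤ := ∑ i ∈ Ico 1 N, ind (c i = false)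
def pB (c : ℕ → Bool) (N : ℕ) : ℤ := ∑ i ∈ Ico 1 N, ind (c i = true)
def pu (c : ℕ → Bool) (N : ℕ) : ℤ := ∑ i ∈ Ico 1 N, ind (c i = false ∧ c (i+1) = false)
def ps (c : ℕ → Bool) (N : ℕ) : ℤ := ∑ i ∈ Ico 1 N, ind (c i = true ∧ c (i+1) = true)
def pI (c : ℕ → Bool) (N : ℕ) : ℤ :=
  ∑ i ∈ Ico 1 N, ind (c i = true ∧ c (i+1) = true) * pu c i
def pD (c : ℕ → Bool) (N : ℕ) : ℤ := ∑ i ∈ Ico 1 N, ind (c i = true) * pW c i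
def pQ (c : ℕ → Bool) (N : ℕ) : ℤ :=
  ∑ i ∈ Ico 1 N, (ind (c i = false) - ind (c i = true)) * Fpos c i

lemma running_inv (c : ℕ → Bool) (h1 : c 1 = true) (N : ℕ) (hN : 1 ≤ N) :
    Fpos c N = pB c (N+1) + pW c (N+1) + pu c N + ps c N ∧
    pB c (N+1) - ps c N - pW c (N+1) + pu c N = ind (c N = true) ∧
    ∃ z : ℤ, 2 * pI c N - 2 * pD c (N+1) - pQ c (N+1) =
      (ps c N)^2 + (2 * ind (c N = true) - 1) * ps c N + 2 * pu c N * ps c N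
        - (pW c (N+1))^2 + pB c (N+1) - pW c (N+1) + 4 * z := by
  induction N, hN using Nat.le_induction with
  | base =>
    refine ⟨?_, ?_, 0, ?_⟩ <;> simp [Fpos, pB, pW, pu, ps, pI, pD, pQ, h1, ind, -Finset.sum_boole]
  | succ m hm ih =>
    obtain ⟨e1, e2, z, e3⟩ := ih
    have hm1 : 1 ≤ m + 1 := by omega
    have f1 : Fpos c (m+1) = Fpos c m + 1 + ind (c m = c (m+1)) := by
      simp only [Fpos]; rw [Finset.sum_Ico_succ_top hm]; push_cast; ring
    have f2 : pB c (m+1+1) = pB c (m+1) + ind (c (m+1) = true) := by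
      rw [pB, Finset.sum_Ico_succ_top hm1]; rfl
    have f3 : pW c (m+1+1) = pW c (m+1) + ind (c (m+1) = false) := by
      rw [pW, Finset.sum_Ico_succ_top hm1]; rfl
    have f4 : pu c (m+1) = pu c m + ind (c m = false ∧ c (m+1) = false) := by
      rw [pu, Finset.sum_Ico_succ_top hm]; rfl
    have f5 : ps c (m+1) = ps c m + ind (c m = true ∧ c (m+1) = true) := by
      rw [ps, Finset.sum_Ico_succ_top hm]; rfl
    have f6 : pI c (m+1) = pI c m + ind (c m = true ∧ c (m+1) = true) * pu c m := by
      rw [pI, Finset.sum_Ico_succ_top hm]; rfl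
    have f7 : pD c (m+1+1) = pD c (m+1) + ind (c (m+1) = true) * pW c (m+1) := by
      rw [pD, Finset.sum_Ico_succ_top hm1]; rfl
    have f8 : pQ c (m+1+1) = pQ c (m+1)
        + (ind (c (m+1) = false) - ind (c (m+1) = true)) * Fpos c (m+1) := by
      rw [pQ, Finset.sum_Ico_succ_top hm1]; rfl
    rw [f8, f7, f6, f5, f4, f3, f2, f1, e1]
    rcases Bool.eq_false_or_eq_true (c m) with a | a <;>
    rcases Bool.eq_false_or_eq_true (c (m+1)) with b | b <;>
    · rw [a] at e2 e3
      rw [a, b]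
      simp only [ind, reduceCtorEq, if_true, if_false, and_true, and_false, and_self] at *
      generalize pB c (m+1) = B at *
      generalize pW c (m+1) = W at *
      generalize pu c m = p at *
      generalize ps c m = q at *
      generalize pI c m = I at *
      generalize pD c (m+1) = D at *
      generalize pQ c (m+1) = Q at *
      refine ⟨by linarith, by linarith, ?_⟩
      first
      | (refine ⟨z, ?_⟩; first | linear_combination e3 | linear_combination e3 + e2 | linear_combination e3 - e2)
      | (refine ⟨z - q, ?_⟩; first | linear_combination e3 | linear_combination e3 + e2 | linear_combination e3 - e2)

lemma nodes_eq (n : ℕ) : nodes n = Ico 1 (2 * n + 1) := by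
  ext i; simp [nodes]

lemma sum_cut (f : ℕ → ℤ) (N s : ℕ) (h : s ≤ N) :
    ∑ i ∈ Ico 1 N, f i * ind (i < s) = ∑ i ∈ Ico 1 s, f i := by
  simp only [ind, mul_ite, mul_one, mul_zero]
  rw [← Finset.sum_filter]
  refine Finset.sum_congr ?_ fun _ _ => rfl
  ext i; simp; omega

lemma sum_blacks_eq (n : ℕ) (c : ℕ → Bool) (g : ℕ → ℤ) :
    ∑ b ∈ blacks n c, g b = ∑ i ∈ Ico 1 (2 * n + 1), ind (c i = true) * g i := by
  rw [blacks, Finset.sum_filter, nodes_eq]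
  refine Finset.sum_congr rfl fun i _ => ?_
  simp [ind]

lemma sum_whites_eq (n : ℕ) (c : ℕ → Bool) (g : ℕ → ℤ) :
    ∑ b ∈ whites n c, g b = ∑ i ∈ Ico 1 (2 * n + 1), ind (c i = false) * g i := by
  rw [whites, Finset.sum_filter, nodes_eq]
  refine Finset.sum_congr rfl fun i _ => ?_
  simp [ind]

lemma Dtot_eq (n : ℕ) (c : ℕ → Bool) : Dtot n c = pD c (2 * n + 1) := by
  rw [Dtot, sum_blacks_eq, pD]
  refine Finset.sum_congr rfl fun i hi => ?_
  rw [sum_whites_eq, sum_cut _ _ _ (by rw [mem_Ico] at hi; omega)]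
  rfl

lemma Qtot_eq (n : ℕ) (c : ℕ → Bool) : Qtot n c = pQ c (2 * n + 1) := by
  rw [Qtot, sum_blacks_eq, sum_whites_eq, pQ, ← Finset.sum_sub_distrib]
  refine Finset.sum_congr rfl fun i hi => ?_
  ring

lemma pB_eq (n : ℕ) (c : ℕ → Bool) (hbal : BalancedColoring n c) : pB c (2 * n + 1) = n := by
  have h := sum_blacks_eq n c (fun _ => 1)
  have h2 : (blacks n c).card = n := hbal
  simp only [Finset.sum_const, h2, mul_one, nsmul_eq_mul] at h
  exact h.symm

lemma pBW (n : ℕ) (c : ℕ → Bool) : pB c (2 * n + 1) + pW c (2 * n + 1) = 2 * n := by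
  rw [pB, pW, ← Finset.sum_add_distrib]
  have : ∀ i ∈ Ico 1 (2 * n + 1), ind (c i = true) + ind (c i = false) = 1 := by
    intro i _
    cases c i <;> rfl
  rw [Finset.sum_congr rfl this]
  simp

lemma sum_S (n : ℕ) (hn : 1 ≤ n) (c : ℕ → Bool) (h1 : c 1 = true) (g : ℕ → ℤ) :
    ∑ s ∈ (couples n c).filter (fun m => c m = c 1), g s
      = ∑ i ∈ Ico 1 (2 * n), ind (c i = true ∧ c (i+1) = true) * g i
        + ind (c (2 * n) = true) * g (2 * n) := by
  rw [couples, Finset.filter_filter, Finset.sum_filter, nodes_eq,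
    Finset.sum_Ico_succ_top (by omega)]
  congr 1
  · refine Finset.sum_congr rfl fun i hi => ?_
    have : i ≠ 2 * n := by rw [mem_Ico] at hi; omega
    simp only [nextNode, this, if_false, h1]
    cases c i <;> cases c (i+1) <;> simp [ind]
  · simp only [nextNode, if_true, h1]
    cases c (2 * n) <;> simp [ind]

lemma sum_U (n : ℕ) (hn : 1 ≤ n) (c : ℕ → Bool) (h1 : c 1 = true) (g : ℕ → ℤ) :
    ∑ s ∈ (couples n c).filter (fun m => ¬ c m = c 1), g s
      = ∑ i ∈ Ico 1 (2 * n), ind (c i = false ∧ c (i+1) = false) * g i := by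
  rw [couples, Finset.filter_filter, Finset.sum_filter, nodes_eq,
    Finset.sum_Ico_succ_top (by omega)]
  have : (if c (2 * n) = c (nextNode n (2 * n)) ∧ ¬ c (2 * n) = c 1 then g (2 * n) else 0) = 0 := by
    simp only [nextNode, if_true, h1]
    cases c (2 * n) <;> simp
  rw [this, add_zero]
  refine Finset.sum_congr rfl fun i hi => ?_
  have : i ≠ 2 * n := by rw [mem_Ico] at hi; omega
  simp only [nextNode, this, if_false, h1]
  cases c i <;> cases c (i+1) <;> simp [ind]

/-- number of inversions in `signCons` -/
def consInv (n : ℕ) (c : ℕ → Bool) : ℕ := ((couples n c ×ˢ couples n c).filter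
    (fun p => p.1 < p.2 ∧ phiCouple n c p.2 < phiCouple n c p.1)).card

lemma coloring_true (n : ℕ) (hn : 1 ≤ n) (c : ℕ → Bool) (hbal : BalancedColoring n c)
    (h1 : c 1 = true) :
    2 * (consInv n c : ℤ) ≡ n * (n - 1) + 2 * Dtot n c + Qtot n c - n [ZMOD 4] := by
  have hS := sum_S n hn c h1
  have hU := sum_U n hn c h1
  have hcons := fun k => cons_inv n c _ _ k rfl rfl
  set S := (couples n c).filter (fun m => c m = c 1) with hSdef
  set U := (couples n c).filter (fun m => ¬ c m = c 1) with hUdef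
  obtain ⟨-, e2, z, e3⟩ := running_inv c h1 (2 * n) (by omega)
  have hB := pB_eq n c hbal
  have hW : pW c (2 * n + 1) = n := by have := pBW n c; linarith
  rw [hB, hW] at e2
  rw [← Dtot_eq, ← Qtot_eq, hB, hW] at e3
  have cS : (S.card : ℤ) = ps c (2 * n) + ind (c (2 * n) = true) := by
    have := hS (fun _ => 1)
    simp only [Finset.sum_const, mul_one, nsmul_eq_mul] at this
    exact this
  have cU : (U.card : ℤ) = pu c (2 * n) := by
    have := hU (fun _ => 1)
    simp only [Finset.sum_const, mul_one, nsmul_eq_mul] at this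
    exact this
  have hcard : S.card = U.card := by
    have : (S.card : ℤ) = U.card := by rw [cS, cU]; linarith
    exact_mod_cast this
  have hI : ∑ s ∈ S, ∑ u ∈ U, ind (u < s)
      = pI c (2 * n) + ind (c (2 * n) = true) * pu c (2 * n) := by
    rw [hS, pI]
    congr 1
    · refine Finset.sum_congr rfl fun i hi => ?_
      rw [hU, sum_cut _ _ _ (by rw [mem_Ico] at hi; omega)]
      rfl
    · rw [hU, sum_cut _ _ _ le_rfl]
      rfl
  have h := hcons U.card hcard rfl
  rw [hI, cU] at h
  change 2 * (consInv n c : ℤ) ≡ _ [ZMOD 4] at h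
  refine h.trans ?_
  obtain ⟨t, ht⟩ : ∃ t : ℤ, (n : ℤ) * (n - 1) = 2 * t := by
    have := Int.even_mul_pred_self (n : ℤ)
    obtain ⟨t, ht⟩ := this
    exact ⟨t, by rw [ht]; ring⟩
  generalize pu c (2 * n) = p at *
  generalize ps c (2 * n) = q at *
  generalize pI c (2 * n) = I at *
  generalize Dtot n c = D at *
  generalize Qtot n c = Q at *
  rcases Bool.eq_false_or_eq_true (c (2 * n)) with a | a
  · rw [a] at e2 e3 ⊢
    simp only [ind, if_true] at e2 e3 ⊢
    have hq : q = p - 1 := by linarith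
    subst hq
    refine (Int.modEq_iff_dvd.mpr ⟨-(z + p ^ 2 - t), ?_⟩)
    linear_combination (-1) * e3 + 2 * ht
  · rw [a] at e2 e3 ⊢
    simp only [ind, reduceCtorEq, if_false] at e2 e3 ⊢
    have hq : q = p := by linarith
    subst hq
    refine (Int.modEq_iff_dvd.mpr ⟨-(z + q ^ 2 - t), ?_⟩)
    linear_combination (-1) * e3 + 2 * ht

lemma consInv_not (n : ℕ) (c : ℕ → Bool) : consInv n (fun i => !(c i)) = consInv n c := by
  have h1 : couples n (fun i => !(c i)) = couples n c := by
    simp [couples]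
  have h2 : ∀ m, phiCouple n (fun i => !(c i)) m = phiCouple n c m := by
    intro m
    simp [phiCouple, h1]
  simp only [consInv, h1, h2]

lemma coloring (n : ℕ) (hn : 1 ≤ n) (c : ℕ → Bool) (hbal : BalancedColoring n c) :
    2 * (consInv n c : ℤ) ≡ n * (n - 1) + 2 * Dtot n c + Qtot n c - n [ZMOD 4] := by
  rcases Bool.eq_false_or_eq_true (c 1) with h | h
  · exact coloring_true n hn c hbal h
  · have hb : blacks n (fun i => !(c i)) = whites n c := by simp [blacks, whites]
    have hw : whites n (fun i => !(c i)) = blacks n c := by simp [blacks, whites]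
    have cB : ((blacks n c).card : ℤ) = n := by
      have : (blacks n c).card = n := hbal
      rw [this]
    have cW : ((whites n c).card : ℤ) = n := by
      have h2 := sum_whites_eq n c (fun _ => 1)
      simp only [Finset.sum_const, mul_one, nsmul_eq_mul] at h2
      have := pBW n c
      rw [pB_eq n c hbal] at this
      rw [pW] at this
      linarith
    have hbal' : BalancedColoring n (fun i => !(c i)) := by
      change (blacks n (fun i => !(c i))).card = n
      rw [hb]; exact_mod_cast cW
    have key := coloring_true n hn (fun i => !(c i)) hbal' (by simp [h])
    rw [consInv_not] at key
    have hQ : Qtot n (fun i => !(c i)) = - Qtot n c := by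
      have : ∀ i, Fpos (fun i => !(c i)) i = Fpos c i := by
        intro i; simp [Fpos]
      simp only [Qtot, hb, hw, this]; ring
    have hD : Dtot n (fun i => !(c i)) = n * n - Dtot n c := by
      have : Dtot n (fun i => !(c i)) + Dtot n c = n * n := by
        rw [Dtot, Dtot, hb, hw, Finset.sum_comm, ← Finset.sum_add_distrib]
        have : ∀ b ∈ blacks n c, ∑ w ∈ whites n c, ind (b < w) + ∑ w ∈ whites n c, ind (w < b)
            = n := by
          intro b hb
          rw [← Finset.sum_add_distrib, ← cW, Finset.card_eq_sum_ones]
          push_cast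
          refine Finset.sum_congr rfl fun w hw => ?_
          have : b ≠ w := by
            rintro rfl
            simp only [blacks, whites, mem_filter] at hb hw
            simp [hb.2] at hw
          rcases lt_or_gt_of_ne this with h | h
          · simp [ind, h, h.not_gt]
          · simp [ind, h, h.not_gt]
        rw [Finset.sum_congr rfl this]
        simp [cB]
      linarith
    rw [hQ, hD] at key
    obtain ⟨t, ht⟩ : ∃ t : ℤ, (n : ℤ) * (n - 1) = 2 * t := by
      have := Int.even_mul_pred_self (n : ℤ)
      obtain ⟨t, ht⟩ := this
      exact ⟨t, by rw [ht]; ring⟩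
    have h3 : (n : ℤ) * n = 2 * t + n := by linarith
    rw [ht, h3] at key
    rw [ht]
    unfold Int.ModEq at *
    omega

end Helpers

/-- Lemma 2.1.14 / analogue of Kuo–Wilson Lemma 3.4.
For every black-white pairing `ρ`,
`sign_cons(N) · sign_BW(ρ) · ∏_{(b,w) ∈ ρ} sign(b,w) = (−1)^{#crossings of ρ}`. -/
theorem statement0 (n : ℕ) (c : ℕ → Bool) (hbal : BalancedColoring n c)
    (ρ : ℕ → ℕ) (hρ : IsPairing n ρ) (hbw : IsBW n c ρ) :
    signCons n c * signBW n c ρ * (∏ b ∈ blacks n c, pairSign c b (ρ b))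
      = (-1 : ℤ) ^ (numCrossings n ρ) := by
  rcases Nat.eq_zero_or_pos n with hn | hn
  · subst hn
    simp [signCons, signBW, blacks, nodes, couples, numCrossings, numCrossingsOn]
  obtain ⟨E, hE, hE2⟩ := prod_exp n c hbal ρ hρ hbw
  have h1 := coloring n hn c hbal
  have h2 := cross_inv n c hbal ρ hρ hbw _ _ rfl rfl
  rw [hE]
  change (-1 : ℤ) ^ (consInv n c) * signBW n c ρ * (-1) ^ E = _
  rw [signBW, ← pow_add, ← pow_add]
  refine neg_one_pow_congr ?_
  rw [Nat.even_iff, Nat.even_iff]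
  unfold Int.ModEq at *
  omega

end DD
end

section
/- Let N = {1,…,2n} carry a coloring with exactly n black and n white nodes. There exists a planar black-white pairing ρ of N such that sign_BW(ρ) · ∏_{(b,w) a pair of ρ} sign(b,w) = sign_cons(N). -/
namespace DD

lemma exists_planar (c : ℕ → Bool) : ∀ (k : ℕ) (S : Finset ℕ), S.card = k →
    (S.filter (fun i => c i = true)).card = (S.filter (fun i => c i = false)).card →
    ∃ ρ : ℕ → ℕ, (∀ i ∈ S, ρ i ∈ S) ∧ (∀ i ∈ S, ρ (ρ i) = i) ∧ (∀ i ∈ S, c (ρ i) = !(c i)) ∧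
      ∀ i ∈ S, ∀ j ∈ S, ¬ (i < j ∧ j < ρ i ∧ ρ i < ρ j) := by
  intro k
  induction k using Nat.strong_induction_on with
  | _ k ih =>
  intro S hS hbal
  by_cases hE : S = ∅
  · subst hE
    exact ⟨id, by simp, by simp, by simp, by simp⟩
  -- there is a pair of opposite colours at minimal distance
  have hex : ∃ d, ∃ x ∈ S, ∃ y ∈ S, x < y ∧ c x ≠ c y ∧ y - x = d := by
    obtain ⟨z, hz⟩ := Finset.nonempty_iff_ne_empty.mpr hE
    have hz' : ∃ w ∈ S, c w ≠ c z := by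
      cases hc : c z with
      | true =>
        have : 0 < (S.filter (fun i => c i = false)).card := by
          rw [← hbal]; exact Finset.card_pos.mpr ⟨z, by simp [hz, hc]⟩
        obtain ⟨w, hw⟩ := Finset.card_pos.mp this
        simp at hw
        exact ⟨w, hw.1, by simp [hw.2]⟩
      | false =>
        have : 0 < (S.filter (fun i => c i = true)).card := by
          rw [hbal]; exact Finset.card_pos.mpr ⟨z, by simp [hz, hc]⟩
        obtain ⟨w, hw⟩ := Finset.card_pos.mp this
        simp at hw
        exact ⟨w, hw.1, by simp [hw.2]⟩
    obtain ⟨w, hw, hwz⟩ := hz'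
    rcases lt_trichotomy w z with h | h | h
    · exact ⟨_, w, hw, z, hz, h, hwz, rfl⟩
    · exact absurd (by rw [h]) hwz
    · exact ⟨_, z, hz, w, hw, h, hwz.symm, rfl⟩
  classical
  obtain ⟨x, hx, y, hy, hxy, hcxy, hd⟩ := Nat.find_spec hex
  have hmin : ∀ x' ∈ S, ∀ y' ∈ S, x' < y' → c x' ≠ c y' → y - x ≤ y' - x' := by
    intro x' hx' y' hy' h1 h2
    rw [hd]
    exact Nat.find_min' hex ⟨x', hx', y', hy', h1, h2, rfl⟩
  have hbet : ∀ z ∈ S, ¬ (x < z ∧ z < y) := by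
    rintro z hz ⟨h1, h2⟩
    by_cases hzx : c z = c x
    · have := hmin z hz y hy h2 (by rw [hzx]; exact hcxy)
      omega
    · have := hmin x hx z hz h1 (fun h => hzx h.symm)
      omega
  have hT : ((S.erase x).erase y).card < k := by
    rw [← hS]
    exact lt_of_le_of_lt (Finset.card_le_card (Finset.erase_subset _ _))
      (Finset.card_erase_lt_of_mem hx)
  have hcount : ∀ b : Bool, (((S.erase x).erase y).filter (fun i => c i = b)).card + 1
      = (S.filter (fun i => c i = b)).card := by
    intro b
    rw [Finset.filter_erase, Finset.filter_erase]
    by_cases hb : c x = b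
    · have h1 : y ∉ (S.filter (fun i => c i = b)).erase x := by
        simp; intro _ _ h; exact hcxy (hb.trans h.symm)
      rw [Finset.erase_eq_of_notMem h1]
      exact Finset.card_erase_add_one (by simp [hx, hb])
    · have hb' : c y = b := by
        revert hb hcxy; cases c x <;> cases c y <;> cases b <;> simp
      have h1 : x ∉ (S.filter (fun i => c i = b)) := by
        simp [hb]
      rw [Finset.erase_eq_of_notMem h1]
      exact Finset.card_erase_add_one (by simp [hy, hb'])
  obtain ⟨ρ, h1, h2, h3, h4⟩ := ih _ hT ((S.erase x).erase y) rfl (by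
    have e1 := hcount true
    have e2 := hcount false
    omega)
  simp only [Finset.mem_erase] at h1 h2 h3 h4
  have hcyx : c y = !(c x) := by
    revert hcxy; cases c x <;> cases c y <;> simp
  clear ih hcount hT hmin hd hex hbal hS hE
  have h1a : ∀ i, i ∈ S → i ≠ x → i ≠ y → ρ i ∈ S := fun i a b d => (h1 i ⟨d, b, a⟩).2.2
  have h1b : ∀ i, i ∈ S → i ≠ x → i ≠ y → ρ i ≠ x := fun i a b d => (h1 i ⟨d, b, a⟩).2.1
  have h1c : ∀ i, i ∈ S → i ≠ x → i ≠ y → ρ i ≠ y := fun i a b d => (h1 i ⟨d, b, a⟩).1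
  have hyx : y ≠ x := by omega
  refine ⟨fun i => if i = x then y else if i = y then x else ρ i, ?_, ?_, ?_, ?_⟩
  · intro i hi
    by_cases e1 : i = x
    · simp [e1, hy]
    by_cases e2 : i = y
    · simp [e2, hyx, hx]
    simp [e1, e2, h1a i hi e1 e2]
  · intro i hi
    by_cases e1 : i = x
    · simp [e1, hyx]
    by_cases e2 : i = y
    · simp [e2, hyx]
    simp [e1, e2, h1b i hi e1 e2, h1c i hi e1 e2, h2 i ⟨e2, e1, hi⟩]
  · intro i hi
    by_cases e1 : i = x
    · simp [e1, hcyx]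
    by_cases e2 : i = y
    · simp [e2, hyx, hcyx]
    simp [e1, e2, h3 i ⟨e2, e1, hi⟩]
  · intro i hi j hj
    have bj := hbet j hj
    by_cases e1 : i = x
    · simp only [e1, if_true]; omega
    by_cases e2 : i = y
    · simp only [e2, hyx, if_true, if_false]; omega
    have bi := hbet _ (h1a i hi e1 e2)
    have bi1 := h1b i hi e1 e2
    have bi2 := h1c i hi e1 e2
    simp only [e1, e2, if_false]
    by_cases f1 : j = x
    · simp only [f1, if_true]; omega
    by_cases f2 : j = y
    · simp only [f2, hyx, if_true, if_false]; omega
    simp only [f1, f2, if_false]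
    exact h4 i ⟨e2, e1, hi⟩ j ⟨f2, f1, hj⟩

lemma couple_count (c : ℕ → Bool) (x y : ℕ) (hxy : x < y) (hc : c x ≠ c y) :
    ((Finset.Ico x y).filter (fun i => c i = true ∧ c (i + 1) = true)).card + (y - x)
      = ((Finset.Ico x y).filter (fun i => c i = false ∧ c (i + 1) = false)).card
        + 2 * ((Finset.Ico (x + 1) y).filter (fun i => c i = true)).card + 1 := by
  have key : ∑ i ∈ Finset.Ico x y, ((if c i = true ∧ c (i + 1) = true then 1 else 0) + 1)
      = ∑ i ∈ Finset.Ico x y, ((if c i = false ∧ c (i + 1) = false then 1 else 0)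
        + (if c i = true then 1 else 0) + (if c (i + 1) = true then 1 else 0)) := by
    apply Finset.sum_congr rfl
    intro i _
    cases c i <;> cases c (i + 1) <;> simp
  rw [Finset.sum_add_distrib, Finset.sum_add_distrib, Finset.sum_add_distrib] at key
  have h1 : ∑ i ∈ Finset.Ico x y, (if c i = true then 1 else 0)
      = (if c x = true then 1 else 0) + ∑ i ∈ Finset.Ico (x + 1) y, (if c i = true then 1 else 0) :=
    Finset.sum_eq_sum_Ico_succ_bot hxy _
  have h2 : ∑ i ∈ Finset.Ico x y, (if c (i + 1) = true then 1 else 0)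
      = ∑ i ∈ Finset.Ico (x + 1) y, (if c i = true then 1 else 0) + (if c y = true then 1 else 0) := by
    rw [Finset.sum_Ico_add' (fun i => if c i = true then 1 else 0) x y 1]
    exact Finset.sum_Ico_succ_top (by omega) _
  have h3 : (if c x = true then 1 else 0) + (if c y = true then 1 else 0) = 1 := by
    revert hc; cases c x <;> cases c y <;> simp
  rw [h1, h2] at key
  simp only [← Finset.card_filter] at key
  simp only [Finset.sum_const, Nat.card_Ico, smul_eq_mul, mul_one] at key
  omega

lemma same_count (c : ℕ → Bool) (x y : ℕ) :
    ((Finset.Ico x y).filter (fun i => c i = c (i + 1))).card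
      = ((Finset.Ico x y).filter (fun i => c i = true ∧ c (i + 1) = true)).card
        + ((Finset.Ico x y).filter (fun i => c i = false ∧ c (i + 1) = false)).card := by
  simp only [Finset.card_filter]
  rw [← Finset.sum_add_distrib]
  apply Finset.sum_congr rfl
  intro i _
  cases c i <;> cases c (i + 1) <;> simp

/-- the working hypotheses on the pairing -/
structure Good (M : ℕ) (c : ℕ → Bool) (ρ : ℕ → ℕ) : Prop where
  maps : ∀ i ∈ Finset.Icc 1 M, ρ i ∈ Finset.Icc 1 M
  inv : ∀ i ∈ Finset.Icc 1 M, ρ (ρ i) = i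
  bw : ∀ i ∈ Finset.Icc 1 M, c (ρ i) = !(c i)
  pl : ∀ i ∈ Finset.Icc 1 M, ∀ j ∈ Finset.Icc 1 M, ¬ (i < j ∧ j < ρ i ∧ ρ i < ρ j)

lemma Good.nofix {M : ℕ} {c : ℕ → Bool} {ρ : ℕ → ℕ} (h : Good M c ρ) {i : ℕ}
    (hi : i ∈ Finset.Icc 1 M) : ρ i ≠ i := by
  intro e
  have := h.bw i hi
  rw [e] at this
  revert this; cases c i <;> simp

lemma Good.inside {M : ℕ} {c : ℕ → Bool} {ρ : ℕ → ℕ} (h : Good M c ρ) {x : ℕ}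
    (hx : x ∈ Finset.Icc 1 M) (hlt : x < ρ x) :
    ∀ i ∈ Finset.Ico (x + 1) (ρ x), i ∈ Finset.Icc 1 M ∧ ρ i ∈ Finset.Ico (x + 1) (ρ x) := by
  intro i hi
  have hy := h.maps x hx
  have hi' : i ∈ Finset.Icc 1 M := by
    simp only [Finset.mem_Icc, Finset.mem_Ico] at *; omega
  refine ⟨hi', ?_⟩
  have h1 := h.pl x hx i hi'
  have h2 := h.pl (ρ i) (h.maps i hi') x hx
  rw [h.inv i hi'] at h2
  have h3 : ρ i ≠ x := by
    intro e
    have := h.inv i hi'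
    rw [e] at this
    simp only [Finset.mem_Ico] at hi; omega
  have h4 : ρ i ≠ ρ x := by
    intro e
    have := h.inv i hi'
    rw [e, h.inv x hx] at this
    simp only [Finset.mem_Ico] at hi; omega
  simp only [Finset.mem_Ico] at *
  omega

lemma Good.half {M : ℕ} {c : ℕ → Bool} {ρ : ℕ → ℕ} (h : Good M c ρ) {x : ℕ}
    (hx : x ∈ Finset.Icc 1 M) (hlt : x < ρ x) :
    ρ x - x = 2 * ((Finset.Ico (x + 1) (ρ x)).filter (fun i => c i = true)).card + 1 := by
  have hin := h.inside hx hlt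
  have e1 : ((Finset.Ico (x + 1) (ρ x)).filter (fun i => c i = true)).card
      = ((Finset.Ico (x + 1) (ρ x)).filter (fun i => ¬ c i = true)).card := by
    apply Finset.card_nbij' ρ ρ
    · intro i hi
      simp only [Finset.coe_filter, Set.mem_ofPred_eq] at hi ⊢
      refine ⟨(hin i hi.1).2, ?_⟩
      rw [h.bw i (hin i hi.1).1, hi.2]; simp
    · intro i hi
      simp only [Finset.coe_filter, Set.mem_ofPred_eq] at hi ⊢
      refine ⟨(hin i hi.1).2, ?_⟩
      rw [h.bw i (hin i hi.1).1]; simpa using hi.2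
    · intro i hi
      simp only [Finset.coe_filter, Set.mem_ofPred_eq] at hi
      exact h.inv i (hin i hi.1).1
    · intro i hi
      simp only [Finset.coe_filter, Set.mem_ofPred_eq] at hi
      exact h.inv i (hin i hi.1).1
  have e2 := Finset.card_filter_add_card_filter_not (s := Finset.Ico (x + 1) (ρ x))
    (fun i => c i = true)
  rw [Nat.card_Ico] at e2
  omega

/-- exponent for the sign of a chord -/
lemma Good.chord {M : ℕ} {c : ℕ → Bool} {ρ : ℕ → ℕ} (h : Good M c ρ) {b : ℕ}
    (hb : b ∈ Finset.Icc 1 M) :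
    (max b (ρ b) - min b (ρ b) + aCount c b (ρ b) - 1) / 2
      = ((Finset.Ico (min b (ρ b) + 1) (max b (ρ b))).filter (fun i => c i = true)).card
        + ((Finset.Ico (min b (ρ b)) (max b (ρ b))).filter
            (fun i => c i = true ∧ c (i + 1) = true)).card := by
  have main : ∀ x ∈ Finset.Icc 1 M, x < ρ x →
      (ρ x - x + ((Finset.Ico x (ρ x)).filter (fun i => c i = c (i + 1))).card - 1) / 2
      = ((Finset.Ico (x + 1) (ρ x)).filter (fun i => c i = true)).card
        + ((Finset.Ico x (ρ x)).filter (fun i => c i = true ∧ c (i + 1) = true)).card := by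
    intro x hx hlt
    have e1 := h.half hx hlt
    have e2 := couple_count c x (ρ x) hlt (by
      rw [h.bw x hx]; cases c x <;> simp)
    have e3 := same_count c x (ρ x)
    omega
  unfold aCount
  rcases lt_or_gt_of_ne (h.nofix hb) with hlt | hlt
  · have := main (ρ b) (h.maps b hb) (by rw [h.inv b hb]; exact hlt)
    rw [h.inv b hb] at this
    rw [max_eq_left hlt.le, min_eq_right hlt.le]
    exact this
  · rw [max_eq_right hlt.le, min_eq_left hlt.le]
    exact main b hb hlt

/-- inversions correspond to nested chords -/
lemma Good.inversions {M : ℕ} {c : ℕ → Bool} {ρ : ℕ → ℕ} (h : Good M c ρ) :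
    (((Finset.Icc 1 M ×ˢ Finset.Icc 1 M).filter
      (fun p => c p.1 = true ∧ c p.2 = true ∧ p.1 < p.2 ∧ ρ p.2 < ρ p.1)).card)
    = ∑ b ∈ (Finset.Icc 1 M).filter (fun i => c i = true),
      ((Finset.Ico (min b (ρ b) + 1) (max b (ρ b))).filter (fun i => c i = true)).card := by
  have hN : ∀ b ∈ Finset.Icc 1 M, 
      ((Finset.Ico (min b (ρ b) + 1) (max b (ρ b))).filter (fun i => c i = true)).card
      = ∑ b' ∈ Finset.Icc 1 M,
        if c b' = true ∧ min b (ρ b) < b' ∧ b' < max b (ρ b) then 1 else 0 := by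
    intro b hb
    rw [← Finset.card_filter]
    congr 1
    have := h.maps b hb
    ext i
    simp only [Finset.mem_filter, Finset.mem_Ico, Finset.mem_Icc] at *
    constructor
    · rintro ⟨⟨h1, h2⟩, h3⟩
      refine ⟨⟨?_, ?_⟩, h3, ?_, h2⟩ <;> omega
    · rintro ⟨h1, h2, h3, h4⟩
      exact ⟨⟨h3, h4⟩, h2⟩
  rw [Finset.sum_filter, Finset.card_filter, Finset.sum_product]
  have e1 : ∀ b ∈ Finset.Icc 1 M, (if c b = true then
      ((Finset.Ico (min b (ρ b) + 1) (max b (ρ b))).filter (fun i => c i = true)).card else 0)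
      = ∑ b' ∈ Finset.Icc 1 M,
        (if c b = true ∧ c b' = true ∧ b < b' ∧ b' < ρ b then 1 else 0)
       + ∑ b' ∈ Finset.Icc 1 M,
        (if c b = true ∧ c b' = true ∧ ρ b < b' ∧ b' < b then 1 else 0) := by
    intro b hb
    rw [hN b hb, ← Finset.sum_add_distrib]
    by_cases hc : c b = true
    · rw [if_pos hc]
      apply Finset.sum_congr rfl
      intro b' hb'
      have := h.nofix hb
      by_cases hc' : c b' = true
      · simp only [hc, hc', true_and]
        split_ifs <;> omega
      · simp [hc']
    · simp [hc]
  rw [Finset.sum_congr rfl e1, Finset.sum_add_distrib, 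
    Finset.sum_comm (f := fun b b' => if c b = true ∧ c b' = true ∧ ρ b < b' ∧ b' < b then 1 else 0),
    ← Finset.sum_add_distrib]
  apply Finset.sum_congr rfl
  intro p hp
  rw [← Finset.sum_add_distrib]
  apply Finset.sum_congr rfl
  intro q hq
  by_cases hc : c p = true
  swap
  · simp [hc]
  by_cases hc' : c q = true
  swap
  · simp [hc']
  simp only [hc, hc', true_and]
  have a1 := h.pl p hp q hq
  have a2 := h.pl (ρ q) (h.maps q hq) (ρ p) (h.maps p hp)
  have a3 := h.pl p hp (ρ q) (h.maps q hq)
  have a4 := h.pl (ρ q) (h.maps q hq) p hp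
  have b1 := h.pl q hq p hp
  have b2 := h.pl (ρ p) (h.maps p hp) (ρ q) (h.maps q hq)
  have b3 := h.pl q hq (ρ p) (h.maps p hp)
  have b4 := h.pl (ρ p) (h.maps p hp) q hq
  rw [h.inv p hp, h.inv q hq] at a2 b2
  rw [h.inv q hq] at a3 a4
  rw [h.inv p hp] at b3 b4
  have n1 := h.nofix hp
  have n2 := h.nofix hq
  have n3 : ρ p ≠ q := by
    intro e
    have := h.bw p hp
    rw [e, hc, hc'] at this; simp at this
  have n4 : ρ q ≠ p := by
    intro e
    have := h.bw q hq
    rw [e, hc, hc'] at this; simp at this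
  have n5 : ρ p = ρ q → p = q := by
    intro e
    rw [← h.inv p hp, e, h.inv q hq]
  split_ifs <;> omega

/-- parity of the number of chords over `m` -/
lemma Good.cover {M : ℕ} {c : ℕ → Bool} {ρ : ℕ → ℕ} (h : Good M c ρ) {m : ℕ} (hm : m ≤ M) :
    ∑ b ∈ (Finset.Icc 1 M).filter (fun i => c i = true),
      (if min b (ρ b) ≤ m ∧ m < max b (ρ b) then 1 else 0 : ZMod 2) = m := by
  have e1 : ∀ b, (if min b (ρ b) ≤ m ∧ m < max b (ρ b) then 1 else 0 : ZMod 2)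
      = (if b ≤ m then 1 else 0) + (if ρ b ≤ m then 1 else 0) := by
    intro b
    have t : (1 : ZMod 2) + 1 = 0 := by decide
    split_ifs <;> first | omega | simp [t]
  simp only [e1]
  rw [Finset.sum_add_distrib]
  have e2 : ∑ b ∈ (Finset.Icc 1 M).filter (fun i => c i = true), (if ρ b ≤ m then 1 else 0 : ZMod 2)
      = ∑ b ∈ (Finset.Icc 1 M).filter (fun i => ¬ c i = true), (if b ≤ m then 1 else 0 : ZMod 2) := by
    apply Finset.sum_nbij' ρ ρ
    · intro i hi
      simp only [Finset.mem_filter] at hi ⊢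
      refine ⟨h.maps i hi.1, ?_⟩
      rw [h.bw i hi.1, hi.2]; simp
    · intro i hi
      simp only [Finset.mem_filter] at hi ⊢
      refine ⟨h.maps i hi.1, ?_⟩
      rw [h.bw i hi.1]; simpa using hi.2
    · intro i hi
      simp only [Finset.mem_filter] at hi
      exact h.inv i hi.1
    · intro i hi
      simp only [Finset.mem_filter] at hi
      exact h.inv i hi.1
    · intro i hi; rfl
  rw [e2, Finset.sum_filter_add_sum_filter_not, Finset.sum_boole]
  congr 1
  have : (Finset.Icc 1 M).filter (fun i => i ≤ m) = Finset.Icc 1 m := by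
    ext i; simp only [Finset.mem_filter, Finset.mem_Icc]; omega
  rw [this]; simp

lemma Good.total {M : ℕ} {c : ℕ → Bool} {ρ : ℕ → ℕ} (h : Good M c ρ) :
    ((∑ b ∈ (Finset.Icc 1 M).filter (fun i => c i = true),
      ((Finset.Ico (min b (ρ b)) (max b (ρ b))).filter
            (fun i => c i = true ∧ c (i + 1) = true)).card : ℕ) : ZMod 2)
    = ∑ m ∈ (Finset.Ico 1 M).filter (fun i => c i = true ∧ c (i + 1) = true), (m : ZMod 2) := by
  rw [Nat.cast_sum]
  have e1 : ∀ b ∈ (Finset.Icc 1 M).filter (fun i => c i = true),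
      (((Finset.Ico (min b (ρ b)) (max b (ρ b))).filter
            (fun i => c i = true ∧ c (i + 1) = true)).card : ZMod 2)
      = ∑ m ∈ (Finset.Ico 1 M).filter (fun i => c i = true ∧ c (i + 1) = true),
        (if min b (ρ b) ≤ m ∧ m < max b (ρ b) then 1 else 0 : ZMod 2) := by
    intro b hb
    rw [Finset.sum_boole]
    congr 2
    simp only [Finset.mem_filter] at hb
    have h1 := hb.1
    have h2 := h.maps b hb.1
    ext i
    simp only [Finset.mem_filter, Finset.mem_Ico, Finset.mem_Icc] at *
    constructor
    · rintro ⟨⟨a1, a2⟩, a3⟩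
      refine ⟨⟨⟨?_, ?_⟩, a3⟩, a1, a2⟩ <;> omega
    · rintro ⟨⟨a1, a2⟩, a3⟩
      exact ⟨a3, a2⟩
  rw [Finset.sum_congr rfl e1, Finset.sum_comm]
  apply Finset.sum_congr rfl
  intro m hm
  simp only [Finset.mem_filter, Finset.mem_Ico] at hm
  exact h.cover (by omega)

lemma mem_couples (n : ℕ) (c : ℕ → Bool) (m : ℕ) : m ∈ couples n c ↔
    (1 ≤ m ∧ m ≤ 2 * n) ∧ c m = c (if m = 2 * n then 1 else m + 1) := by
  unfold couples
  rw [Finset.mem_filter]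
  unfold nodes nextNode
  rw [Finset.mem_Icc]

lemma rank_lt (S : Finset ℕ) {p q : ℕ} (hq : q ∈ S) (hpq : p < q) :
    (S.filter (fun w => w ≤ p)).card < (S.filter (fun w => w ≤ q)).card := by
  apply Finset.card_lt_card
  rw [Finset.ssubset_iff_of_subset]
  · exact ⟨q, by simp [hq], by simp [hpq]⟩
  · intro w hw
    simp only [Finset.mem_filter] at hw ⊢
    exact ⟨hw.1, by omega⟩

lemma rank_count (S : Finset ℕ) (r : ℕ) (hr : r ≤ S.card) :
    (S.filter (fun w => (S.filter (fun w' => w' ≤ w)).card ≤ r)).card = r := by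
  have hinj : Set.InjOn (fun w => (S.filter (fun w' => w' ≤ w)).card) (S : Set ℕ) := by
    intro p hp q hq e
    by_contra hne
    rcases lt_or_gt_of_ne hne with h | h
    · have := rank_lt S hq h
      simp only at e; omega
    · have := rank_lt S hp h
      simp only at e; omega
  have him : S.image (fun w => (S.filter (fun w' => w' ≤ w)).card) = Finset.Icc 1 S.card := by
    apply Finset.eq_of_subset_of_card_le
    · intro v hv
      simp only [Finset.mem_image] at hv
      obtain ⟨w, hw, rfl⟩ := hv
      rw [Finset.mem_Icc]
      exact ⟨Finset.card_pos.mpr ⟨w, by simp [hw]⟩, Finset.card_filter_le _ _⟩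
    · rw [Finset.card_image_of_injOn hinj]; simp
  have h2 : (S.filter (fun w => (S.filter (fun w' => w' ≤ w)).card ≤ r)).image
      (fun w => (S.filter (fun w' => w' ≤ w)).card) = Finset.Icc 1 r := by
    ext v
    simp only [Finset.mem_image, Finset.mem_filter, Finset.mem_Icc]
    constructor
    · rintro ⟨w, ⟨hw, hwr⟩, rfl⟩
      exact ⟨Finset.card_pos.mpr ⟨w, by simp [hw]⟩, hwr⟩
    · rintro ⟨h1, h2⟩
      have : v ∈ S.image (fun w => (S.filter (fun w' => w' ≤ w)).card) := by
        rw [him, Finset.mem_Icc]; omega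
      simp only [Finset.mem_image] at this
      obtain ⟨w, hw, rfl⟩ := this
      exact ⟨w, ⟨hw, h2⟩, rfl⟩
  rw [← Finset.card_image_of_injOn (hinj.mono (by
    intro x hx
    simp only [Finset.coe_filter, Set.mem_ofPred_eq] at hx
    exact hx.1)), h2]
  simp

/-- node colours and number of couples -/
lemma colour_parity (c : ℕ → Bool) (m : ℕ) (hm : 1 ≤ m) :
    (((Finset.Ico 1 m).filter (fun i => c i = c (i + 1))).card : ZMod 2) + m + 1
      = (if c m = true then 1 else 0) + (if c 1 = true then 1 else 0) := by
  have t : (1 : ZMod 2) + 1 = 0 := by decide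
  induction m, hm using Nat.le_induction with
  | base => split_ifs <;> simp [t]
  | succ k hk ih =>
    have e : (((Finset.Ico 1 (k + 1)).filter (fun i => c i = c (i + 1))).card : ZMod 2)
        = (((Finset.Ico 1 k).filter (fun i => c i = c (i + 1))).card : ZMod 2)
          + (if c k = c (k + 1) then 1 else 0) := by
      rw [← Finset.sum_boole, ← Finset.sum_boole, Finset.sum_Ico_succ_top hk]
    rw [e]
    push_cast
    have e2 : (if c (k + 1) = true then 1 else 0 : ZMod 2)
      = (if c k = true then 1 else 0) + (if c k = c (k + 1) then 1 else 0) + 1 := by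
      cases c k <;> cases c (k + 1) <;> simp [t]
    rw [e2]
    linear_combination ih

lemma couples_balanced (n : ℕ) (c : ℕ → Bool) (hbal : BalancedColoring n c) :
    ((couples n c).filter (fun m => c m = true)).card
      = ((couples n c).filter (fun m => c m = false)).card := by
  unfold BalancedColoring at hbal
  have key : ∑ i ∈ nodes n, ((if c i = c (nextNode n i) ∧ c i = true then 1 else 0) + 1)
      = ∑ i ∈ nodes n, ((if c i = c (nextNode n i) ∧ c i = false then 1 else 0)
        + (if c i = true then 1 else 0) + (if c (nextNode n i) = true then 1 else 0)) := by
    apply Finset.sum_congr rfl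
    intro i _
    cases c i <;> cases c (nextNode n i) <;> simp
  rw [Finset.sum_add_distrib, Finset.sum_add_distrib, Finset.sum_add_distrib] at key
  have h2 : ∑ i ∈ nodes n, (if c (nextNode n i) = true then 1 else 0)
      = ∑ i ∈ nodes n, (if c i = true then 1 else 0) := by
    apply Finset.sum_nbij' (nextNode n) (fun m => if m = 1 then 2 * n else m - 1)
    · intro i hi
      simp only [nodes, nextNode, Finset.mem_Icc] at hi ⊢
      split_ifs <;> omega
    · intro i hi
      simp only [nodes, Finset.mem_Icc] at hi ⊢
      split_ifs <;> omega
    · intro i hi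
      simp only [nodes, nextNode, Finset.mem_Icc] at hi ⊢
      split_ifs <;> omega
    · intro i hi
      simp only [nodes, nextNode, Finset.mem_Icc] at hi ⊢
      split_ifs <;> omega
    · intro i hi; rfl
  rw [h2] at key
  simp only [← Finset.card_filter] at key
  have h3 : (nodes n).card = 2 * n := by simp [nodes]
  simp only [Finset.sum_const, smul_eq_mul, mul_one] at key
  unfold couples
  rw [Finset.filter_filter, Finset.filter_filter]
  omega

lemma phi_lt (n : ℕ) (c : ℕ → Bool) {p q : ℕ} (hp : p ∈ couples n c) (hq : q ∈ couples n c)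
    (hpq : p < q) (hc : c p = c q) : phiCouple n c p < phiCouple n c q := by
  have h1 := rank_lt ((couples n c).filter (fun m => c m = c q)) (p := p) (q := q)
    (by simp [hq]) hpq
  rw [Finset.filter_filter, Finset.filter_filter] at h1
  unfold phiCouple
  rw [hc]
  have h2 : 0 < ((couples n c).filter (fun m' => c m' = c q ∧ m' ≤ p)).card :=
    Finset.card_pos.mpr ⟨p, by simp [hp, hc]⟩
  split_ifs <;> omega

lemma phi_ne (n : ℕ) (c : ℕ → Bool) {p q : ℕ} (hp : p ∈ couples n c) (hq : q ∈ couples n c)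
    (hc : c p ≠ c q) : phiCouple n c p ≠ phiCouple n c q := by
  unfold phiCouple
  have h1 : 0 < ((couples n c).filter (fun m' => c m' = c p ∧ m' ≤ p)).card :=
    Finset.card_pos.mpr ⟨p, by simp [hp]⟩
  have h2 : 0 < ((couples n c).filter (fun m' => c m' = c q ∧ m' ≤ q)).card :=
    Finset.card_pos.mpr ⟨q, by simp [hq]⟩
  by_cases e1 : c p = c 1
  · have e2 : c q ≠ c 1 := fun h => hc (e1.trans h.symm)
    rw [if_pos e1, if_neg e2]; omega
  · have e2 : c q = c 1 := by
      revert hc e1; cases c p <;> cases c q <;> cases c 1 <;> simp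
    rw [if_neg e1, if_pos e2]; omega

/-- number of white couples with a smaller value of `φ` than a black one -/
lemma phi_count (n : ℕ) (c : ℕ → Bool) (hbal : BalancedColoring n c) {p : ℕ}
    (hp : p ∈ couples n c) (hc : c p = true) :
    (((couples n c).filter (fun m => c m = false)).filter
      (fun q => phiCouple n c q ≤ phiCouple n c p)).card + (if c 1 = true then 0 else 1)
    = ((couples n c).filter (fun m' => c m' = true ∧ m' ≤ p)).card := by
  have hb := couples_balanced n c hbal
  set R := ((couples n c).filter (fun m' => c m' = true ∧ m' ≤ p)).card with hR
  set W := (couples n c).filter (fun m => c m = false) with hW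
  have hR1 : 0 < R := Finset.card_pos.mpr ⟨p, by simp [hp, hc]⟩
  have hR2 : R ≤ W.card := by
    rw [← hb, hR, ← Finset.filter_filter]
    exact Finset.card_filter_le _ _
  have hq : ∀ q ∈ W, ((phiCouple n c q ≤ phiCouple n c p) ↔
      (W.filter (fun w => w ≤ q)).card ≤ R - (if c 1 = true then 0 else 1)) := by
    intro q hq
    have hqc : c q = false := by
      rw [hW, Finset.mem_filter] at hq; exact hq.2
    have hr : 0 < (W.filter (fun w => w ≤ q)).card := Finset.card_pos.mpr ⟨q, by simp [hq]⟩
    have e : ((couples n c).filter (fun m' => c m' = false ∧ m' ≤ q)).card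
      = (W.filter (fun w => w ≤ q)).card := by
      rw [hW, Finset.filter_filter]
    unfold phiCouple
    rw [hqc, hc, e, ← hR]
    cases c 1
    · simp; omega
    · simp; omega
  rw [Finset.filter_congr hq, rank_count W _ (by omega)]
  split_ifs <;> omega

lemma before_count (n : ℕ) (c : ℕ → Bool) {p : ℕ} (hp : p ∈ couples n c) (hc : c p = true) :
    (((couples n c).filter (fun q => q ≤ p)).card : ZMod 2)
      = p + (if c 1 = true then 0 else 1) := by
  have t : (1 : ZMod 2) + 1 = 0 := by decide
  have hp1 : 1 ≤ p ∧ p ≤ 2 * n := by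
    have := (Finset.mem_filter.mp hp).1
    simpa [nodes] using this
  have e : (couples n c).filter (fun q => q ≤ p)
      = insert p ((Finset.Ico 1 p).filter (fun i => c i = c (i + 1))) := by
    ext q
    simp only [Finset.mem_insert, Finset.mem_filter, Finset.mem_Ico]
    constructor
    · rintro ⟨h1, h2⟩
      rcases h2.eq_or_lt with h3 | h3
      · exact Or.inl h3
      · right
        rw [mem_couples] at h1
        rw [if_neg (by omega)] at h1
        exact ⟨⟨h1.1.1, h3⟩, h1.2⟩
    · rintro (h | ⟨h1, h2⟩)
      · subst h; exact ⟨hp, le_refl _⟩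
      · refine ⟨?_, by omega⟩
        rw [mem_couples]
        rw [if_neg (by omega)]
        exact ⟨by omega, h2⟩
  have h := colour_parity c p hp1.1
  rw [e, Finset.card_insert_of_notMem (by simp)]
  push_cast
  rw [hc] at h
  simp only [if_true] at h
  have e3 : (if c 1 = true then 0 else 1 : ZMod 2) = (if c 1 = true then 1 else 0) + 1 := by
    cases c 1 <;> simp [t]
  have t2 : (2 : ZMod 2) = 0 := by decide
  rw [e3]
  linear_combination h - (p : ZMod 2) * t2

lemma cons_exponent (n : ℕ) (c : ℕ → Bool) (hbal : BalancedColoring n c) :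
    ((((couples n c ×ˢ couples n c).filter
      (fun p => p.1 < p.2 ∧ phiCouple n c p.2 < phiCouple n c p.1)).card : ℕ) : ZMod 2)
    = ∑ m ∈ (couples n c).filter (fun m => c m = true), (m : ZMod 2) := by
  have t : (1 : ZMod 2) + 1 = 0 := by decide
  have t2 : (2 : ZMod 2) = 0 := by decide
  rw [← Finset.sum_boole, Finset.sum_product]
  have e1 : ∀ p ∈ couples n c, ∑ q ∈ couples n c,
      (if p < q ∧ phiCouple n c q < phiCouple n c p then 1 else 0 : ZMod 2)
      = ∑ q ∈ couples n c, (if c p = true ∧ c q = false ∧ p < q ∧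
          phiCouple n c q < phiCouple n c p then 1 else 0 : ZMod 2)
        + ∑ q ∈ couples n c, (if c q = true ∧ c p = false ∧ p < q ∧
          phiCouple n c q < phiCouple n c p then 1 else 0 : ZMod 2) := by
    intro p hp
    rw [← Finset.sum_add_distrib]
    apply Finset.sum_congr rfl
    intro q hq
    by_cases hc : c p = c q
    · have : ¬ (p < q ∧ phiCouple n c q < phiCouple n c p) := by
        rintro ⟨h1, h2⟩
        have := phi_lt n c hp hq h1 hc
        omega
      rw [if_neg this, if_neg (fun h => this h.2.2), if_neg (fun h => this h.2.2)]; simp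
    · cases h1 : c p <;> cases h2 : c q <;> simp_all
  simp only at e1 ⊢
  rw [Finset.sum_congr rfl e1, Finset.sum_add_distrib, Finset.sum_comm
    (f := fun p q => (if c q = true ∧ c p = false ∧ p < q ∧
          phiCouple n c q < phiCouple n c p then 1 else 0 : ZMod 2)), ← Finset.sum_add_distrib,
    Finset.sum_filter]
  apply Finset.sum_congr rfl
  intro p hp
  rw [← Finset.sum_add_distrib]
  by_cases hc : c p = true
  swap
  · simp [hc]
  rw [if_pos hc]
  have e2 : ∀ q ∈ couples n c, 
      (if c p = true ∧ c q = false ∧ p < q ∧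
          phiCouple n c q < phiCouple n c p then 1 else 0 : ZMod 2)
      + (if c p = true ∧ c q = false ∧ q < p ∧
          phiCouple n c p < phiCouple n c q then 1 else 0 : ZMod 2)
      = (if c q = false then ((if q ≤ p then 1 else 0)
        + (if phiCouple n c q ≤ phiCouple n c p then 1 else 0)) else 0) := by
    intro q hq
    by_cases hc' : c q = false
    · have h1 := phi_ne n c hp hq (by rw [hc, hc']; simp)
      have h2 : p ≠ q := by
        rintro rfl
        rw [hc] at hc'; simp at hc'
      simp only [hc, hc', true_and, if_true]
      split_ifs <;> first | omega | simp [t]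
    · simp [hc']
  rw [Finset.sum_congr rfl e2, ← Finset.sum_filter, Finset.sum_add_distrib,
    Finset.sum_boole, Finset.sum_boole]
  have f1 := congrArg (Nat.cast : ℕ → ZMod 2) (phi_count n c hbal hp hc)
  have f2 := before_count n c hp hc
  have f3 : ((couples n c).filter (fun q => q ≤ p)).card
      = ((couples n c).filter (fun m' => c m' = true ∧ m' ≤ p)).card
        + (((couples n c).filter (fun m => c m = false)).filter (fun q => q ≤ p)).card := by
    rw [Finset.filter_filter]
    simp only [Finset.card_filter]
    rw [← Finset.sum_add_distrib]
    apply Finset.sum_congr rfl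
    intro q _
    cases c q <;> simp
  have f4 := congrArg (Nat.cast : ℕ → ZMod 2) f3
  push_cast at f1 f4
  rw [f2] at f4
  set I : ZMod 2 := if c 1 = true then 0 else 1
  linear_combination f1 - f4

lemma neg_one_pow_congr {a b : ℕ} (h : (a : ZMod 2) = b) : (-1 : ℤ) ^ a = (-1) ^ b := by
  rw [ZMod.natCast_eq_natCast_iff'] at h
  rw [neg_one_pow_eq_pow_mod_two a, neg_one_pow_eq_pow_mod_two b, h]

/-- there is a planar black-white pairing `ρ` with
`sign_BW(ρ) · ∏_{(b,w) ∈ ρ} sign(b,w) = sign_cons(N)`. -/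
theorem statement1 (n : ℕ) (c : ℕ → Bool) (hbal : BalancedColoring n c) :
    ∃ ρ : ℕ → ℕ, IsPairing n ρ ∧ IsBW n c ρ ∧ IsPlanar n ρ ∧
      signBW n c ρ * (∏ b ∈ blacks n c, pairSign c b (ρ b)) = signCons n c := by
  have hcard : (nodes n).card = 2 * n := by simp [nodes]
  have hsplit := Finset.card_filter_add_card_filter_not (s := nodes n) (fun i => c i = true)
  obtain ⟨ρ, h1, h2, h3, h4⟩ := exists_planar c _ (nodes n) rfl (by
    unfold BalancedColoring at hbal
    simp only [Bool.not_eq_true] at hsplit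
    omega)
  have hg : Good (2 * n) c ρ := ⟨h1, h2, h3, h4⟩
  refine ⟨ρ, ⟨h1, h2, fun i hi => hg.nofix hi⟩, h3, ?_, ?_⟩
  · unfold IsPlanar numCrossings numCrossingsOn
    rw [Finset.card_eq_zero, Finset.filter_eq_empty_iff]
    rintro ⟨i, j⟩ hij
    rw [Finset.mem_product] at hij
    exact h4 i hij.1 j hij.2
  · unfold signBW signCons pairSign
    rw [Finset.prod_pow_eq_pow_sum, ← pow_add]
    apply neg_one_pow_congr
    rw [cons_exponent n c hbal]
    have e1 : ∑ b ∈ blacks n c, (max b (ρ b) - min b (ρ b) + aCount c b (ρ b) - 1) / 2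
        = ∑ b ∈ (Finset.Icc 1 (2 * n)).filter (fun i => c i = true),
          (((Finset.Ico (min b (ρ b) + 1) (max b (ρ b))).filter (fun i => c i = true)).card
        + ((Finset.Ico (min b (ρ b)) (max b (ρ b))).filter
            (fun i => c i = true ∧ c (i + 1) = true)).card) := by
      unfold blacks nodes
      apply Finset.sum_congr rfl
      intro b hb
      exact hg.chord (Finset.mem_filter.mp hb).1
    rw [e1, Finset.sum_add_distrib]
    unfold nodes
    rw [hg.inversions, Nat.cast_add, Nat.cast_add, hg.total]
    have t2 : (2 : ZMod 2) = 0 := by decide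
    rw [← add_assoc, ← two_mul, t2, zero_mul, zero_add]
    apply Finset.sum_subset
    · intro m hm
      simp only [mem_couples, Finset.mem_filter,
        Finset.mem_Ico] at hm ⊢
      rw [if_neg (by omega)]
      exact ⟨⟨by omega, by rw [hm.2.1, hm.2.2]⟩, hm.2.1⟩
    · intro m hm hm'
      simp only [mem_couples, Finset.mem_filter,
        Finset.mem_Ico] at hm hm'
      by_cases hmn : m = 2 * n
      · rw [hmn]; push_cast; rw [t2, zero_mul]
      · exfalso
        rw [if_neg hmn] at hm
        exact hm' ⟨by omega, hm.2, by rw [← hm.1.2, hm.2]⟩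

end DD
end

section
/- Let N = {1,…,2n} carry a coloring with exactly n black and n white nodes, let T be the set of nodes that are either odd and white or even and black, and let S ⊆ N be balanced. Let x ∈ S and y ∈ N \ S be nodes of the same color with x < y such that every node strictly between x and y has the opposite color. Let ρ be a black-white pairing with ρ(S) = S whose restrictions to S and to N \ S have no crossings. Suppose ρ(x) does not lie strictly between x and y, and some node strictly between x and y lies in S; let k be the least positive integer with x + k ∈ S, and let ρ' be the pairing obtained from ρ by replacing the pairs (x, ρ(x)) and (x+k, ρ(x+k)) with the pairs (x, x+k) and (ρ(x), ρ(x+k)). Then ρ' is a black-white pairing with ρ'(S) = S whose restrictions to S and to N \ S have no crossings. -/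
namespace DD

lemma noCross_iff (A : Finset ℕ) (ρ : ℕ → ℕ) : numCrossingsOn A ρ = 0 ↔
    ∀ p ∈ A, ∀ q ∈ A, p < q → q < ρ p → ρ p < ρ q → False := by
  unfold numCrossingsOn
  rw [Finset.card_eq_zero, Finset.filter_eq_empty_iff]
  constructor
  · intro h p hp q hq h1 h2 h3
    exact h (Finset.mk_mem_product hp hq) ⟨h1, h2, h3⟩
  · rintro h ⟨p, q⟩ hpq ⟨h1, h2, h3⟩
    rw [Finset.mem_product] at hpq
    exact h p hpq.1 q hpq.2 h1 h2 h3

lemma sep_aux (S : Finset ℕ) (ρ : ℕ → ℕ) (hinv : ∀ i ∈ S, ρ i ∈ S)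
    (hii : ∀ i ∈ S, ρ (ρ i) = i)
    (H : ∀ p ∈ S, ∀ q ∈ S, p < q → q < ρ p → ρ p < ρ q → False)
    (p q : ℕ) (hp : p ∈ S) (hq : q ∈ S) (h1 : q ≠ p) (h2 : q ≠ ρ p)
    (h3 : p < q) (h4 : q < ρ p) : p < ρ q ∧ ρ q < ρ p := by
  have a1 := H p hp q hq h3 h4
  have a2 := H (ρ q) (hinv q hq) p hp
  rw [hii q hq] at a2
  have e1 : ρ q ≠ p := fun h => h2 (by rw [← h, hii q hq])
  have e2 : ρ q ≠ ρ p := fun h => h1 (by rw [← hii q hq, h, hii p hp])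
  constructor
  · by_contra hc
    exact a2 (by omega) h3 h4
  · by_contra hc
    exact a1 (by omega)

lemma sep (S : Finset ℕ) (ρ : ℕ → ℕ) (hinv : ∀ i ∈ S, ρ i ∈ S)
    (hii : ∀ i ∈ S, ρ (ρ i) = i)
    (H : ∀ p ∈ S, ∀ q ∈ S, p < q → q < ρ p → ρ p < ρ q → False)
    (p q : ℕ) (hp : p ∈ S) (hq : q ∈ S) (h1 : q ≠ p) (h2 : q ≠ ρ p) :
    (p < q ∧ q < ρ p) ↔ (p < ρ q ∧ ρ q < ρ p) := by
  constructor
  · rintro ⟨h3, h4⟩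
    exact sep_aux S ρ hinv hii H p q hp hq h1 h2 h3 h4
  · rintro ⟨h3, h4⟩
    have := sep_aux S ρ hinv hii H p (ρ q) hp (hinv q hq) (by omega) (by omega) h3 h4
    rwa [hii q hq] at this

/-- rearranging a black-white pairing that is planar on `S` and on its
complement, by pairing `x` with the nearest member `x+k` of `S` to its right, preserves
all these properties. -/
theorem statement3 (n : ℕ) (c : ℕ → Bool) (hbal : BalancedColoring n c)
    (S : Finset ℕ) (hS : S ⊆ nodes n) (hSbal : BalancedSubset c S)
    (x y : ℕ) (hxS : x ∈ S) (hy : y ∈ nodes n) (hyS : y ∉ S)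
    (hcxy : c x = c y) (hxy : x < y)
    (hbetween : ∀ i, x < i → i < y → c i = !(c x))
    (ρ : ℕ → ℕ) (hρ : IsPairing n ρ) (hbw : IsBW n c ρ) (hinv : Invariant S ρ)
    (hplS : numCrossingsOn S ρ = 0) (hplSc : numCrossingsOn (nodes n \ S) ρ = 0)
    (hρx : ¬ (x < ρ x ∧ ρ x < y))
    (hmidS : ∃ i, x < i ∧ i < y ∧ i ∈ S)
    (k : ℕ) (hk0 : 0 < k) (hkS : x + k ∈ S)
    (hkmin : ∀ j, 0 < j → j < k → x + j ∉ S) :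
    letI ρ' : ℕ → ℕ := fun i =>
      if i = x then x + k
      else if i = x + k then x
      else if i = ρ x then ρ (x + k)
      else if i = ρ (x + k) then ρ x
      else ρ i
    IsPairing n ρ' ∧ IsBW n c ρ' ∧ Invariant S ρ' ∧
      numCrossingsOn S ρ' = 0 ∧ numCrossingsOn (nodes n \ S) ρ' = 0 := by
  generalize hgen : (fun i : ℕ => if i = x then x + k
      else if i = x + k then x
      else if i = ρ x then ρ (x + k)
      else if i = ρ (x + k) then ρ x
      else ρ i) = ρ'
  have hzy : x + k < y := by
    obtain ⟨i, h1, h2, h3⟩ := hmidS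
    by_contra hc
    apply hkmin (i - x) (by omega) (by omega)
    rwa [Nat.add_sub_cancel' h1.le]
  have hcz := hbetween (x + k) (by omega) hzy
  have hgap : ∀ j ∈ S, ¬ (x < j ∧ j < x + k) := by
    rintro j hj ⟨h1, h2⟩
    apply hkmin (j - x) (by omega) (by omega)
    rwa [Nat.add_sub_cancel' h1.le]
  have hii : ∀ i ∈ S, ρ (ρ i) = i := fun i hi => hρ.invol i (hS hi)
  rw [noCross_iff] at hplS hplSc
  obtain ⟨z, hz⟩ : ∃ z, z = x + k := ⟨_, rfl⟩
  obtain ⟨a, ha⟩ : ∃ a, a = ρ x := ⟨_, rfl⟩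
  obtain ⟨d, hd⟩ : ∃ d, d = ρ z := ⟨_, rfl⟩
  have hρ' : ∀ i, ρ' i = if i = x then z else if i = z then x else if i = a then d
      else if i = d then a else ρ i := by
    intro i
    rw [← hgen, ha, hd, hz]
  rw [← hz] at hkS hcz hzy hgap
  have haS : a ∈ S := ha ▸ hinv x hxS
  have hdS : d ∈ S := hd ▸ hinv z hkS
  have hρa : ρ a = x := by rw [ha, hii x hxS]
  have hρd : ρ d = z := by rw [hd, hii z hkS]
  have hca : c a = !(c x) := ha ▸ hbw x (hS hxS)
  have hcd : c d = !(c z) := hd ▸ hbw z (hS hkS)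
  have hxz : x < z := by omega
  have hax : a ≠ x := ha ▸ hρ.nofix x (hS hxS)
  have hdz : d ≠ z := hd ▸ hρ.nofix z (hS hkS)
  have haz : a ≠ z := by
    intro h
    apply hρx
    rw [← ha]; omega
  have hdx : d ≠ x := by
    intro h
    apply haz
    rw [ha, ← h, hρd]
  have had : a ≠ d := by
    intro h
    have : ρ a = ρ d := by rw [h]
    omega
  have hx' : ρ' x = z := by simp [hρ']
  have hz' : ρ' z = x := by simp [hρ', hxz.ne']
  have ha' : ρ' a = d := by simp [hρ', hax, haz]
  have hd' : ρ' d = a := by simp [hρ', hdx, hdz, had.symm]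
  have ho' : ∀ i, i ≠ x → i ≠ z → i ≠ a → i ≠ d → ρ' i = ρ i := by
    intro i h1 h2 h3 h4
    simp [hρ', h1, h2, h3, h4]
  have hoρ : ∀ i ∈ nodes n, i ≠ x → i ≠ z → i ≠ a → i ≠ d →
      ρ i ≠ x ∧ ρ i ≠ z ∧ ρ i ≠ a ∧ ρ i ≠ d := by
    intro i hi h1 h2 h3 h4
    have := hρ.invol i hi
    refine ⟨?_, ?_, ?_, ?_⟩ <;> intro h <;> rw [h] at this <;> omega
  have cases5 : ∀ i, i = x ∨ i = z ∨ i = a ∨ i = d ∨ (i ≠ x ∧ i ≠ z ∧ i ≠ a ∧ i ≠ d) := by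
    intro i; omega
  have hinv' : Invariant S ρ' := by
    intro i hi
    rcases cases5 i with rfl | rfl | rfl | rfl | ⟨h1, h2, h3, h4⟩
    · rwa [hx']
    · rwa [hz']
    · rwa [ha']
    · rwa [hd']
    · rw [ho' i h1 h2 h3 h4]; exact hinv i hi
  refine ⟨⟨?_, ?_, ?_⟩, ?_, hinv', ?_, ?_⟩
  · intro i hi
    by_cases hiS : i ∈ S
    · exact hS (hinv' i hiS)
    · rw [ho' i (fun h => hiS (h ▸ hxS)) (fun h => hiS (h ▸ hkS)) (fun h => hiS (h ▸ haS))
        (fun h => hiS (h ▸ hdS))]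
      exact hρ.maps i hi
  · intro i hi
    rcases cases5 i with h | h | h | h | ⟨h1, h2, h3, h4⟩
    · rw [h, hx', hz']
    · rw [h, hz', hx']
    · rw [h, ha', hd']
    · rw [h, hd', ha']
    · obtain ⟨g1, g2, g3, g4⟩ := hoρ i hi h1 h2 h3 h4
      rw [ho' i h1 h2 h3 h4, ho' _ g1 g2 g3 g4, hρ.invol i hi]
  · intro i hi
    rcases cases5 i with h | h | h | h | ⟨h1, h2, h3, h4⟩
    · rw [h, hx']; omega
    · rw [h, hz']; omega
    · rw [h, ha']; omega
    · rw [h, hd']; omega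
    · rw [ho' i h1 h2 h3 h4]; exact hρ.nofix i hi
  · intro i hi
    rcases cases5 i with h | h | h | h | ⟨h1, h2, h3, h4⟩
    · rw [h, hx', hcz]
    · rw [h, hz', hcz, Bool.not_not]
    · rw [h, ha', hcd, hcz, hca]
    · rw [h, hd', hcd, hcz, hca, Bool.not_not]
    · rw [ho' i h1 h2 h3 h4]; exact hbw i hi
  · rw [noCross_iff]
    have key : ∀ p ∈ S, p ≠ x → p ≠ z → p ≠ a → p ≠ d →
        ((p < a ∧ a < ρ p) ↔ (p < d ∧ d < ρ p)) := by
      intro p hp h1 h2 h3 h4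
      obtain ⟨g1, g2, g3, g4⟩ := hoρ p (hS hp) h1 h2 h3 h4
      have s1 := sep S ρ hinv hii hplS p x hp hxS h1.symm g1.symm
      have s2 := sep S ρ hinv hii hplS p z hp hkS h2.symm g2.symm
      rw [← ha] at s1
      rw [← hd] at s2
      rw [← s1, ← s2]
      have b1 := hgap p hp
      have b2 := hgap _ (hinv p hp)
      omega
    intro p hp q hq l1 l2 l3
    have b1 := hgap q hq
    have b2 := hgap _ (hinv' p hp)
    rcases cases5 p with h | h | h | h | ⟨h1, h2, h3, h4⟩
    · rw [h, hx'] at l2; omega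
    · rw [h, hz'] at l2; omega
    all_goals
      rcases cases5 q with h' | h' | h' | h' | ⟨h1', h2', h3', h4'⟩
    all_goals first
      | rw [h', hx'] at l3; omega
      | rw [h', hz'] at l3; omega
      | skip
    · omega
    · rw [h, ha'] at l2; omega
    · have := key q hq h1' h2' h3' h4'
      rw [h, ha', ho' q h1' h2' h3' h4'] at l3
      rw [h, ha'] at l2
      omega
    · rw [h, hd'] at l2; omega
    · omega
    · have := key q hq h1' h2' h3' h4'
      rw [h, hd', ho' q h1' h2' h3' h4'] at l3
      rw [h, hd'] at l2
      omega
    · have := key p hp h1 h2 h3 h4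
      rw [h', ha', ho' p h1 h2 h3 h4] at l3
      rw [ho' p h1 h2 h3 h4] at l2
      omega
    · have := key p hp h1 h2 h3 h4
      rw [h', hd', ho' p h1 h2 h3 h4] at l3
      rw [ho' p h1 h2 h3 h4] at l2
      omega
    · rw [ho' p h1 h2 h3 h4, ho' q h1' h2' h3' h4'] at l3
      rw [ho' p h1 h2 h3 h4] at l2
      exact hplS p hp q hq l1 l2 l3
  · rw [noCross_iff]
    have hc : ∀ i ∈ nodes n \ S, ρ' i = ρ i := by
      intro i hi
      have hiS := (Finset.mem_sdiff.1 hi).2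
      exact ho' i (fun h => hiS (h ▸ hxS)) (fun h => hiS (h ▸ hkS)) (fun h => hiS (h ▸ haS))
        (fun h => hiS (h ▸ hdS))
    intro p hp q hq
    rw [hc p hp, hc q hq]
    exact hplSc p hp q hq

end DD
end

section
/- Let N = {1,…,2n} carry a coloring with exactly n black and n white nodes, and let T be the set of nodes that are either odd and white or even and black. For every balanced subset S ⊆ N there exist an odd-even pairing π of N with π(S △ T) = S △ T and a black-white pairing ρ of N with ρ(S) = S whose restrictions to S and to N \ S have no crossings. -/
namespace DD

/-- Sign of a Boolean. -/
def sg (b : Bool) : ℤ := if b then 1 else -1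

lemma exists_planar_s15 (f : ℕ → Bool) : ∀ (m : ℕ) (A : Finset ℕ), A.card = m →
    ∑ i ∈ A, sg (f i) = 0 →
    ∃ ρ : ℕ → ℕ, ∀ i ∈ A, ρ i ∈ A ∧ ρ (ρ i) = i ∧ f (ρ i) = !(f i) ∧
      ∀ j ∈ A, ¬ (i < j ∧ j < ρ i ∧ ρ i < ρ j) := by
  intro m
  induction m using Nat.strong_induction_on with
  | _ m ih =>
  intro A hA hsum
  rcases A.eq_empty_or_nonempty with rfl | ⟨x, hx⟩
  · exact ⟨id, by simp⟩
  have hy : ∃ y ∈ A, f y ≠ f x := by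
    by_contra! h
    rw [Finset.sum_congr rfl (fun i hi => by rw [h i hi])] at hsum
    rw [Finset.sum_const, smul_eq_zero] at hsum
    rcases hsum with h0 | h0
    · exact Finset.card_ne_zero_of_mem hx h0
    · revert h0; unfold sg; split <;> simp
  obtain ⟨y, hyA, hxy⟩ := hy
  have hex : ∃ d a b, a ∈ A ∧ b ∈ A ∧ a < b ∧ f a ≠ f b ∧ b - a = d := by
    rcases lt_trichotomy x y with h | h | h
    · exact ⟨_, x, y, hx, hyA, h, hxy.symm, rfl⟩
    · exact absurd (by rw [h]) hxy
    · exact ⟨_, y, x, hyA, hx, h, hxy, rfl⟩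
  classical
  obtain ⟨a, b, ha, hb, hab, hfab, hd⟩ := Nat.find_spec hex
  have hbet : ∀ z ∈ A, a < z → z < b → False := by
    intro z hz h1 h2
    by_cases hfz : f a = f z
    · exact Nat.find_min hex (m := b - z) (by omega)
        ⟨z, b, hz, hb, h2, by rw [← hfz]; exact hfab, rfl⟩
    · exact Nat.find_min hex (m := z - a) (by omega) ⟨a, z, ha, hz, h1, hfz, rfl⟩
  have hbe : b ∈ A.erase a := Finset.mem_erase.2 ⟨by omega, hb⟩
  have hs1 := Finset.add_sum_erase A (fun i => sg (f i)) ha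
  have hs2 := Finset.add_sum_erase (A.erase a) (fun i => sg (f i)) hbe
  have hs3 : sg (f a) + sg (f b) = 0 := by
    revert hfab; cases f a <;> cases f b <;> simp [sg]
  have hc1 := Finset.card_erase_add_one ha
  have hc2 := Finset.card_erase_add_one hbe
  obtain ⟨ρ, hρ⟩ := ih _ (by omega) ((A.erase a).erase b) rfl
    (by linarith)
  have hmem : ∀ i, i ∈ (A.erase a).erase b ↔ i ≠ b ∧ i ≠ a ∧ i ∈ A := by
    intro i; simp [Finset.mem_erase]
  simp only [hmem] at hρ
  have hab' : a ≠ b := by omega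
  have hfb : f b = !(f a) := by revert hfab; cases f a <;> cases f b <;> simp
  refine ⟨fun i => if i = a then b else if i = b then a else ρ i, ?_⟩
  intro i hi
  by_cases hia : i = a
  · subst hia
    simp only [if_true, hab'.symm, if_false]
    refine ⟨hb, trivial, hfb, fun j hj h => hbet j hj h.1 h.2.1⟩
  by_cases hib : i = b
  · subst hib
    simp only [if_true, hia, if_false]
    refine ⟨ha, trivial, by simp [hfb], fun j hj h => by omega⟩
  obtain ⟨⟨h1, h2, h3⟩, h4, h5, h6⟩ := hρ i ⟨hib, hia, hi⟩
  simp only [hia, hib, h1, h2, if_false]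
  refine ⟨h3, h4, h5, fun j hj h => ?_⟩
  by_cases hja : j = a
  · subst hja
    simp only [if_true] at h
    exact hbet _ h3 h.2.1 h.2.2
  by_cases hjb : j = b
  · subst hjb
    simp only [if_true, hja, if_false] at h
    omega
  simp only [hja, hjb, if_false] at h
  exact h6 j ⟨hjb, hja, hj⟩ h

lemma sum_sg (A : Finset ℕ) (f : ℕ → Bool) : ∑ i ∈ A, sg (f i) =
    ((A.filter (fun i => f i = true)).card : ℤ) - (A.filter (fun i => f i = false)).card := by
  rw [Finset.card_filter, Finset.card_filter]
  push_cast
  rw [← Finset.sum_sub_distrib]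
  refine Finset.sum_congr rfl fun i _ => ?_
  cases f i <;> simp [sg]

lemma combine (n : ℕ) (f : ℕ → Bool) (S : Finset ℕ) (hS : S ⊆ nodes n)
    (h1 : ∑ i ∈ S, sg (f i) = 0) (h2 : ∑ i ∈ nodes n, sg (f i) = 0) :
    ∃ ρ : ℕ → ℕ, IsPairing n ρ ∧ (∀ i ∈ nodes n, f (ρ i) = !(f i)) ∧ Invariant S ρ ∧
      numCrossingsOn S ρ = 0 ∧ numCrossingsOn (nodes n \ S) ρ = 0 := by
  obtain ⟨ρ, hρ⟩ := exists_planar_s15 f _ S rfl h1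
  have h3 := Finset.sum_sdiff (f := fun i => sg (f i)) hS
  obtain ⟨τ, hτ⟩ := exists_planar_s15 f _ (nodes n \ S) rfl (by linarith)
  have key : ∀ i ∈ nodes n, (i ∈ S ∧ ρ i ∈ S) ∨ (i ∉ S ∧ τ i ∉ S) := by
    intro i hi
    by_cases h : i ∈ S
    · exact Or.inl ⟨h, (hρ i h).1⟩
    · exact Or.inr ⟨h, (Finset.mem_sdiff.1 (hτ i (Finset.mem_sdiff.2 ⟨hi, h⟩)).1).2⟩
  have hcol : ∀ i ∈ nodes n, f (if i ∈ S then ρ i else τ i) = !(f i) := by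
    intro i hi
    by_cases h : i ∈ S
    · simpa [h] using (hρ i h).2.2.1
    · simpa [h] using (hτ i (Finset.mem_sdiff.2 ⟨hi, h⟩)).2.2.1
  refine ⟨fun i => if i ∈ S then ρ i else τ i, ⟨?_, ?_, ?_⟩, hcol, ?_, ?_, ?_⟩
  · intro i hi
    by_cases h : i ∈ S
    · simpa [h] using hS (hρ i h).1
    · simpa [h] using (Finset.mem_sdiff.1 (hτ i (Finset.mem_sdiff.2 ⟨hi, h⟩)).1).1
  · intro i hi
    rcases key i hi with ⟨h, h'⟩ | ⟨h, h'⟩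
    · simpa [h, h'] using (hρ i h).2.1
    · simpa [h, h'] using (hτ i (Finset.mem_sdiff.2 ⟨hi, h⟩)).2.1
  · intro i hi h
    have := hcol i hi
    rw [h] at this
    revert this; cases f i <;> simp
  · intro i hi
    simpa [hi] using (hρ i hi).1
  · unfold numCrossingsOn
    rw [Finset.card_eq_zero, Finset.filter_eq_empty_iff]
    rintro ⟨i, j⟩ hij
    obtain ⟨hi, hj⟩ := Finset.mem_product.1 hij
    simp only at hi hj
    simp only [hi, hj, if_true]
    exact (hρ i hi).2.2.2 j hj
  · unfold numCrossingsOn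
    rw [Finset.card_eq_zero, Finset.filter_eq_empty_iff]
    rintro ⟨i, j⟩ hij
    obtain ⟨hi, hj⟩ := Finset.mem_product.1 hij
    simp only at hi hj
    simp only [(Finset.mem_sdiff.1 hi).2, (Finset.mem_sdiff.1 hj).2, if_false]
    exact (hτ i hi).2.2.2 j hj

lemma sum_parity (n : ℕ) : ∑ i ∈ nodes n, sg (decide (i % 2 = 1)) = 0 := by
  unfold nodes
  induction n with
  | zero => simp
  | succ k ih =>
    rw [show 2 * (k + 1) = 2 * k + 1 + 1 by ring, Finset.sum_Icc_succ_top (by omega),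
      Finset.sum_Icc_succ_top (by omega), ih]
    have e1 : (2 * k + 1) % 2 = 1 := by omega
    have e2 : (2 * k + 1 + 1) % 2 = 0 := by omega
    rw [e1, e2]; simp [sg]

/-- for every balanced `S` there exist an odd-even pairing `π` with
`π(S ∆ T) = S ∆ T` and a black-white pairing `ρ` with `ρ(S) = S` that is planar on `S`
and on its complement. -/
theorem statement15 (n : ℕ) (c : ℕ → Bool) (hbal : BalancedColoring n c)
    (S : Finset ℕ) (hS : S ⊆ nodes n) (hSbal : BalancedSubset c S) :
    ∃ π ρ : ℕ → ℕ,
      IsPairing n π ∧ IsOE n π ∧ Invariant (symmDiff S (Tset n c)) π ∧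
      IsPairing n ρ ∧ IsBW n c ρ ∧ Invariant S ρ ∧
      numCrossingsOn S ρ = 0 ∧ numCrossingsOn (nodes n \ S) ρ = 0 := by
  have hSs : ∑ i ∈ S, sg (c i) = 0 := by
    rw [sum_sg]; unfold BalancedSubset at hSbal; rw [hSbal]; simp
  have hN : ∑ i ∈ nodes n, sg (c i) = 0 := by
    rw [sum_sg]
    unfold BalancedColoring at hbal
    have h := Finset.card_filter_add_card_filter_not (s := nodes n) (fun i => c i = true)
    have hc : (nodes n).card = 2 * n := by simp [nodes]
    simp only [Bool.not_eq_true] at h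
    omega
  have hTsub : symmDiff S (Tset n c) ⊆ nodes n := by
    intro i hi
    rcases Finset.mem_symmDiff.1 hi with h | h
    · exact hS h.1
    · exact (Finset.mem_filter.1 h.1).1
  have hT : ∑ i ∈ symmDiff S (Tset n c), sg (decide (i % 2 = 1)) = 0 := by
    have e1 : ∑ i ∈ symmDiff S (Tset n c), sg (decide (i % 2 = 1)) =
        ∑ i ∈ nodes n, if i ∈ symmDiff S (Tset n c) then sg (decide (i % 2 = 1)) else 0 := by
      rw [Finset.sum_ite_mem, Finset.inter_eq_right.2 hTsub]
    have e2 : ∑ i ∈ S, sg (c i) = ∑ i ∈ nodes n, if i ∈ S then sg (c i) else 0 := by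
      rw [Finset.sum_ite_mem, Finset.inter_eq_right.2 hS]
    have e3 : ∑ i ∈ nodes n,
          2 * (if i ∈ symmDiff S (Tset n c) then sg (decide (i % 2 = 1)) else 0) =
        ∑ i ∈ nodes n, (2 * (if i ∈ S then sg (c i) else 0) +
          sg (decide (i % 2 = 1)) - sg (c i)) := by
      refine Finset.sum_congr rfl fun i hi => ?_
      by_cases h : i ∈ S <;> rcases Nat.mod_two_eq_zero_or_one i with hp | hp <;>
        cases hc : c i <;> simp [Finset.mem_symmDiff, Tset, h, hp, hc, hi, sg]
    rw [Finset.sum_sub_distrib, Finset.sum_add_distrib, ← Finset.mul_sum, ← Finset.mul_sum,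
      ← e1, ← e2, hSs, hN, sum_parity] at e3
    linarith
  obtain ⟨π, p1, p2, p3, -, -⟩ := combine n (fun i => decide (i % 2 = 1)) _ hTsub hT (sum_parity n)
  obtain ⟨ρ, r1, r2, r3, r4, r5⟩ := combine n c S hS hSs hN
  refine ⟨π, ρ, p1, ?_, p3, r1, r2, r3, r4, r5⟩
  intro i hi h
  have := p2 i hi
  simp only [h] at this
  revert this
  cases decide (i % 2 = 1) <;> simp

end DD
end
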